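/- Let X be a two-dimensional real normed space whose norm is not induced by an inner product (equivalently, the parallelogram law fails in X), and let G be a finite simple graph with at least one vertex. Then G is isostatic in X — that is, G admits a well-positioned placement p such that the rigidity operator R(p) is surjective and the kernel of R(p) consists exactly of the constant maps — if and only if G is (2,2)-tight. -/

import Mathlib

namespace NormedPlane

open Filter Topology MeasureTheory

section Analysis

variable {X : Type*} [NormedAddCommGroup X] [NormedSpace ℝ X]

/-- Points at which the norm is differentiable. -/
abbrev NormSmooth (x : X) : Prop := DifferentiableAt ℝ (fun y : X => ‖y‖) x

/-- The derivative of the norm. -/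
noncomputable abbrev normDeriv (x : X) : X →L[ℝ] ℝ := fderiv ℝ (fun y : X => ‖y‖) x

/-- Two functionals separate points when their kernels meet trivially. -/
def Separating (f g : X →L[ℝ] ℝ) : Prop := ∀ w, f w = 0 → g w = 0 → w = 0

theorem Separating.symm {f g : X →L[ℝ] ℝ} (h : Separating f g) : Separating g f :=
  fun w hg hf => h w hf hg

theorem normDeriv_self {x : X} (h : NormSmooth x) : normDeriv x x = ‖x‖ :=
  h.fderiv_norm_self

theorem normDeriv_le (x v : X) : normDeriv x v ≤ ‖v‖ := by
  have h1 : ‖normDeriv x‖ ≤ 1 := by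
    simpa using norm_fderiv_le_of_lipschitz ℝ (lipschitzWith_one_norm (E := X)) (x₀ := x)
  calc normDeriv x v ≤ ‖normDeriv x v‖ := le_abs_self _
    _ ≤ ‖normDeriv x‖ * ‖v‖ := (normDeriv x).le_opNorm v
    _ ≤ 1 * ‖v‖ := by gcongr
    _ = ‖v‖ := one_mul _

theorem normDeriv_neg (x : X) : normDeriv (-x) = -normDeriv x := by
  have := fderiv_norm_smul_neg (x := x) (t := -1) (by norm_num)
  simpa using this

theorem normDeriv_smul_eq_or {t : ℝ} (ht : t ≠ 0) (x : X) :
    normDeriv (t • x) = normDeriv x ∨ normDeriv (t • x) = -normDeriv x := by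
  rcases lt_or_gt_of_ne ht with h | h
  · exact Or.inr (fderiv_norm_smul_neg h)
  · exact Or.inl (fderiv_norm_smul_pos h)

theorem normDeriv_smul_apply_eq_zero {t : ℝ} (ht : t ≠ 0) {x w : X} :
    normDeriv (t • x) w = 0 ↔ normDeriv x w = 0 := by
  rcases normDeriv_smul_eq_or ht x with h | h <;> simp [h]

theorem normDeriv_neg_apply_eq_zero {x w : X} :
    normDeriv (-x) w = 0 ↔ normDeriv x w = 0 := by
  simp [normDeriv_neg]

theorem NormSmooth.smul {x : X} (h : NormSmooth x) {t : ℝ} (ht : t ≠ 0) :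
    NormSmooth (t • x) := (differentiableAt_norm_smul ht).1 h

theorem NormSmooth.neg {x : X} (h : NormSmooth x) : NormSmooth (-x) := by
  simpa using h.smul (t := -1) (by norm_num)

theorem normSmooth_neg_iff {x : X} : NormSmooth (-x) ↔ NormSmooth x :=
  ⟨fun h => by simpa using h.neg, fun h => h.neg⟩

theorem normSmooth_sub_comm {x y : X} : NormSmooth (x - y) ↔ NormSmooth (y - x) := by
  rw [← neg_sub, normSmooth_neg_iff]

theorem NormSmooth.ne_zero [Nontrivial X] {x : X} (h : NormSmooth x) : x ≠ 0 :=
  fun hx => not_differentiableAt_norm_zero X (hx ▸ h)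

/-- A smooth point whose norm is attained by a functional of the form `normDeriv x` has that
functional as its derivative. -/
theorem normDeriv_eq_of_apply_eq {x y : X} (hy : NormSmooth y) (h : normDeriv x y = ‖y‖) :
    normDeriv y = normDeriv x := by
  have hmin : IsLocalMin (fun v => ‖v‖ - normDeriv x v) y := by
    refine Eventually.of_forall fun v => ?_
    have := normDeriv_le x v
    simp only [h]
    linarith
  have hd : HasFDerivAt (fun v => ‖v‖ - normDeriv x v) (normDeriv y - normDeriv x) y :=
    hy.hasFDerivAt.sub (normDeriv x).hasFDerivAt
  exact sub_eq_zero.1 (hmin.hasFDerivAt_eq_zero hd)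

/-- The derivative of the norm is continuous on its domain. -/
theorem continuousWithinAt_normDeriv {x : X} (hx : NormSmooth x) :
    ContinuousWithinAt (normDeriv (X := X)) {y | NormSmooth y} x := by
  rw [Metric.continuousWithinAt_iff]
  intro ε hε
  have hd := hx.hasFDerivAt
  rw [hasFDerivAt_iff_isLittleO_nhds_zero] at hd
  have h1 := hd.def (show 0 < ε / 6 by positivity)
  obtain ⟨r, hr, hball⟩ := Metric.eventually_nhds_iff.1 h1
  have hr2 : 0 < r / 2 := by positivity
  refine ⟨ε / 6 * (r / 2) / 2, by positivity, fun y hy hyx => ?_⟩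
  rw [dist_eq_norm] at hyx ⊢
  have key : ∀ h : X, ‖h‖ = r / 2 → (normDeriv y - normDeriv x) h ≤ ε / 2 * ‖h‖ := by
    intro h hh
    have h2 : ‖‖x + h‖ - ‖x‖ - normDeriv x h‖ ≤ ε / 6 * ‖h‖ :=
      hball (by rw [dist_zero_right, hh]; linarith)
    have h3 := le_of_abs_le h2
    have h4 := normDeriv_le y (x + h)
    have h5 := normDeriv_le y (y - x)
    have h6 : normDeriv y (x + h) = ‖y‖ - normDeriv y (y - x) + normDeriv y h := by
      rw [← normDeriv_self hy, map_add, map_sub]; ring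
    have h7 : ‖x‖ ≤ ‖y‖ + ‖y - x‖ := by
      have := norm_sub_norm_le x y
      rw [norm_sub_rev] at this
      linarith
    rw [sub_apply]
    rw [hh] at h3 ⊢
    nlinarith
  have hop : ‖normDeriv y - normDeriv x‖ ≤ ε / 2 := by
    refine ContinuousLinearMap.opNorm_le_bound _ (by positivity) fun v => ?_
    by_cases hv : v = 0
    · simp [hv]
    have hvn : 0 < ‖v‖ := norm_pos_iff.2 hv
    have hs : ∀ s : ℝ, |s| = r / 2 / ‖v‖ →
        s * (normDeriv y - normDeriv x) v ≤ ε / 2 * (r / 2) := by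
      intro s hs
      have hn : ‖s • v‖ = r / 2 := by
        rw [norm_smul, Real.norm_eq_abs, hs]; field_simp
      have := key (s • v) hn
      rwa [hn, map_smul, smul_eq_mul] at this
    have hpos : 0 < r / 2 / ‖v‖ := by positivity
    have ha := hs (r / 2 / ‖v‖) (abs_of_pos hpos)
    have hb := hs (-(r / 2 / ‖v‖)) (by rw [abs_neg, abs_of_pos hpos])
    rw [Real.norm_eq_abs]
    have hc : r / 2 / ‖v‖ * |(normDeriv y - normDeriv x) v| ≤ ε / 2 * (r / 2) := by
      rcases abs_cases ((normDeriv y - normDeriv x) v) with h | h <;> rw [h.1] <;> linarith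
    have hd : r / 2 / ‖v‖ * |(normDeriv y - normDeriv x) v|
        ≤ r / 2 / ‖v‖ * (ε / 2 * ‖v‖) := by
      refine hc.trans (le_of_eq ?_)
      field_simp
    exact le_of_mul_le_mul_left hd hpos
  linarith

section Plane

variable (hdim : Module.finrank ℝ X = 2)
include hdim

theorem nontrivial_of_finrank_two : Nontrivial X :=
  Module.nontrivial_of_finrank_pos (R := ℝ) (by omega)

theorem exists_coords {x y : X} (h : ∀ s t : ℝ, s • x + t • y = 0 → s = 0 ∧ t = 0) (v : X) :
    ∃ a b : ℝ, v = a • x + b • y := by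
  have hli : LinearIndependent ℝ ![x, y] := LinearIndependent.pair_iff.2 h
  have hs := hli.span_eq_top_of_card_eq_finrank (by simp [hdim])
  have hv : v ∈ Submodule.span ℝ (Set.range ![x, y]) := hs ▸ Submodule.mem_top
  rw [Matrix.range_cons, Matrix.range_cons, Matrix.range_empty, Set.union_empty,
    Set.singleton_union, Submodule.mem_span_pair] at hv
  obtain ⟨a, b, hab⟩ := hv
  exact ⟨a, b, hab.symm⟩

theorem exists_ne_zero_apply_eq_zero (f : X →L[ℝ] ℝ) : ∃ w, w ≠ 0 ∧ f w = 0 := by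
  have : FiniteDimensional ℝ X := FiniteDimensional.of_finrank_pos (by omega)
  have h := LinearMap.ker_ne_bot_of_finrank_lt (f := (f : X →ₗ[ℝ] ℝ)) (by simp [hdim])
  obtain ⟨w, hw, hw0⟩ := Submodule.exists_mem_ne_zero_of_ne_bot h
  exact ⟨w, hw0, hw⟩

theorem exists_coords_of_apply {f : X →L[ℝ] ℝ} {x w : X} (hx : f x ≠ 0) (hw : f w = 0)
    (hw0 : w ≠ 0) (v : X) : ∃ a b : ℝ, v = a • x + b • w := by
  refine exists_coords hdim (fun s t hst => ?_) v
  have h1 : s * f x = 0 := by simpa [hw] using congrArg f hst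
  have hs : s = 0 := (mul_eq_zero.1 h1).resolve_right hx
  refine ⟨hs, ?_⟩
  simpa [hs, hw0] using hst

theorem exists_smul_eq_of_apply_eq_zero {f : X →L[ℝ] ℝ} (hf : f ≠ 0) {w v : X} (hw : f w = 0)
    (hw0 : w ≠ 0) (hv : f v = 0) : ∃ c : ℝ, v = c • w := by
  obtain ⟨x, hx⟩ : ∃ x, f x ≠ 0 := by
    by_contra! h
    exact hf (ContinuousLinearMap.ext h)
  obtain ⟨a, b, rfl⟩ := exists_coords_of_apply hdim hx hw hw0 v
  have : a = 0 := by simpa [hw, hx] using hv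
  exact ⟨b, by simp [this]⟩

theorem normDeriv_ne_zero {x : X} (hx : NormSmooth x) : normDeriv x ≠ 0 := by
  have := nontrivial_of_finrank_two hdim
  intro h
  have h1 := normDeriv_self hx
  rw [h] at h1
  exact hx.ne_zero (norm_eq_zero.1 h1.symm)

theorem normDeriv_eq_or_eq_neg {x y w : X} (hx : NormSmooth x) (hy : NormSmooth y)
    (hw0 : w ≠ 0) (hxw : normDeriv x w = 0) (hyw : normDeriv y w = 0) :
    normDeriv y = normDeriv x ∨ normDeriv y = -normDeriv x := by
  have := nontrivial_of_finrank_two hdim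
  have hx1 : normDeriv x x ≠ 0 := by
    rw [normDeriv_self hx]; exact norm_ne_zero_iff.2 hx.ne_zero
  have h : normDeriv y = (normDeriv y x / normDeriv x x) • normDeriv x := by
    ext v
    obtain ⟨a, b, rfl⟩ := exists_coords_of_apply hdim hx1 hxw hw0 v
    simp only [map_add, map_smul, hxw, hyw, smul_eq_mul, mul_zero, add_zero,
      smul_apply]
    field_simp
  set c := normDeriv y x / normDeriv x x
  have hn := norm_fderiv_norm hy
  change ‖normDeriv y‖ = 1 at hn
  have hn' := norm_fderiv_norm hx
  change ‖normDeriv x‖ = 1 at hn'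
  rw [h, norm_smul, hn', mul_one, Real.norm_eq_abs] at hn
  rcases eq_or_eq_neg_of_abs_eq hn with hc | hc
  · left; rw [h, hc, one_smul]
  · right; rw [h, hc]; ext v; simp

theorem not_separating_iff {x y : X} (hx : NormSmooth x) (hy : NormSmooth y) :
    ¬ Separating (normDeriv x) (normDeriv y) ↔
      normDeriv y = normDeriv x ∨ normDeriv y = -normDeriv x := by
  constructor
  · intro h
    unfold Separating at h
    push Not at h
    obtain ⟨w, h1, h2, h0⟩ := h
    exact normDeriv_eq_or_eq_neg hdim hx hy h0 h1 h2
  · intro h hs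
    obtain ⟨w, h0, hw⟩ := exists_ne_zero_apply_eq_zero hdim (normDeriv x)
    exact h0 (hs w hw (by rcases h with h | h <;> simp [h, hw]))

theorem Separating.linearIndependent {x y : X} (hx : NormSmooth x) (hy : NormSmooth y)
    (h : Separating (normDeriv x) (normDeriv y)) (s t : ℝ) (hst : s • x + t • y = 0) :
    s = 0 ∧ t = 0 := by
  have := nontrivial_of_finrank_two hdim
  have ht : t = 0 := by
    by_contra ht
    have hy' : y = (-s / t) • x := by
      have : t • y = (-s) • x := by rw [neg_smul]; exact eq_neg_of_add_eq_zero_right hst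
      rw [div_eq_inv_mul, mul_smul, ← this, smul_smul, inv_mul_cancel₀ ht, one_smul]
    have hc : -s / t ≠ 0 := by
      intro hc
      rw [hc, zero_smul] at hy'
      exact hy.ne_zero hy'
    refine (not_separating_iff hdim hx hy).2 ?_ h
    rw [hy']
    exact normDeriv_smul_eq_or hc x
  refine ⟨?_, ht⟩
  rw [ht, zero_smul, add_zero] at hst
  exact (smul_eq_zero.1 hst).resolve_right hx.ne_zero

theorem exists_separating {x : X} (hx : NormSmooth x) {T : Set X} (hT : Dense T)
    (hTs : ∀ y ∈ T, NormSmooth y) : ∃ y ∈ T, Separating (normDeriv x) (normDeriv y) := by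
  by_contra! hcon
  have hpm : ∀ y ∈ T, ‖y‖ ≤ |normDeriv x y| := by
    intro y hy
    rw [← normDeriv_self (hTs y hy)]
    rcases (not_separating_iff hdim hx (hTs y hy)).1 (hcon y hy) with h | h <;> rw [h]
    · exact le_abs_self _
    · exact neg_le_abs _
  obtain ⟨w, hw0, hw⟩ := exists_ne_zero_apply_eq_zero hdim (normDeriv x)
  have hcl : IsClosed {y : X | ‖y‖ ≤ |normDeriv x y|} :=
    isClosed_le continuous_norm (normDeriv x).continuous.abs
  have : w ∈ {y : X | ‖y‖ ≤ |normDeriv x y|} :=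
    closure_minimal (fun y hy => hpm y hy) hcl (hT w)
  simp only [Set.mem_ofPred_eq, hw, abs_zero, norm_le_zero_iff] at this
  exact hw0 this

end Plane

end Analysis

section Euclidean

variable {X : Type*} [NormedAddCommGroup X] [NormedSpace ℝ X]

/-- A skew operator squaring to `-1` makes the norm invariant under the rotations it generates. -/
theorem norm_rotation_eq {J : X →ₗ[ℝ] X} (hJ : ∀ z, J (J z) = -z)
    (hle : ∀ (z : X) (s : ℝ), ‖z‖ ≤ ‖z + s • J z‖) (θ : ℝ) (z : X) :
    ‖Real.cos θ • z + Real.sin θ • J z‖ = ‖z‖ := by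
  set R : ℝ → X → X := fun θ z => Real.cos θ • z + Real.sin θ • J z with hR
  have hadd : ∀ α β z, R α (R β z) = R (α + β) z := by
    intro α β z
    simp only [hR, map_add, map_smul, hJ, Real.cos_add, Real.sin_add]
    module
  have hcos : ∀ α z, 0 < Real.cos α → Real.cos α * ‖z‖ ≤ ‖R α z‖ := by
    intro α z hα
    have h1 : R α z = Real.cos α • (z + (Real.sin α / Real.cos α) • J z) := by
      simp only [hR, smul_add, smul_smul]
      congr 2
      field_simp
    rw [h1, norm_smul, Real.norm_eq_abs, abs_of_pos hα]
    gcongr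
    exact hle z _
  have hpow : ∀ (α : ℝ) (n : ℕ) (z : X), 0 < Real.cos α →
      Real.cos α ^ n * ‖z‖ ≤ ‖R (n * α) z‖ := by
    intro α n z hα
    induction n with
    | zero => simp [hR]
    | succ n ih =>
      have h1 : R ((n + 1 : ℕ) * α) z = R α (R (n * α) z) := by
        rw [hadd]; congr 1; push_cast; ring
      rw [h1, pow_succ']
      calc Real.cos α * Real.cos α ^ n * ‖z‖ = Real.cos α * (Real.cos α ^ n * ‖z‖) := by ring
        _ ≤ Real.cos α * ‖R (n * α) z‖ := by gcongr
        _ ≤ _ := hcos _ _ hα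
  have hge : ∀ α z, ‖z‖ ≤ ‖R α z‖ := by
    intro α z
    have hlim : Tendsto (fun n : ℕ => (1 - α ^ 2 / 2 / n) * ‖z‖) atTop (𝓝 ((1 - 0) * ‖z‖)) :=
      (tendsto_const_nhds.sub (tendsto_const_div_atTop_nhds_zero_nat _)).mul_const _
    rw [sub_zero, one_mul] at hlim
    refine le_of_tendsto hlim ?_
    obtain ⟨N, hN⟩ := exists_nat_gt (α ^ 2 + |α|)
    filter_upwards [eventually_ge_atTop (N + 1)] with n hn
    have hn' : α ^ 2 + |α| < n := hN.trans (by exact_mod_cast hn)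
    have habs := abs_nonneg α
    have hn0 : (0 : ℝ) < n := by nlinarith [sq_nonneg α]
    have hq : |α / n| < 1 := by
      rw [abs_div, abs_of_pos hn0, div_lt_one hn0]
      nlinarith [sq_nonneg α]
    have hc : 1 - (α / n) ^ 2 / 2 ≤ Real.cos (α / n) := Real.one_sub_sq_div_two_le_cos
    have hsq : (α / n) ^ 2 < 1 := by
      rw [← sq_abs]; nlinarith [abs_nonneg (α / n)]
    have h1 := hpow (α / n) n z (by linarith)
    rw [mul_div_cancel₀ _ hn0.ne'] at h1
    refine le_trans ?_ h1
    gcongr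
    have hb := one_add_mul_le_pow (a := -((α / n) ^ 2 / 2)) (by linarith) n
    calc 1 - α ^ 2 / 2 / n = 1 + n * -((α / n) ^ 2 / 2) := by field_simp; ring
      _ ≤ (1 + -((α / n) ^ 2 / 2)) ^ n := hb
      _ ≤ Real.cos (α / n) ^ n := by
        refine pow_le_pow_left₀ (by linarith) (by linarith) n
  refine le_antisymm ?_ (hge θ z)
  calc ‖R θ z‖ ≤ ‖R (-θ) (R θ z)‖ := hge _ _
    _ = ‖z‖ := by rw [hadd, neg_add_cancel]; simp [hR]

theorem parallelogram_of_complex_structure (hdim : Module.finrank ℝ X = 2) {J : X →ₗ[ℝ] X}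
    (hJ : ∀ z, J (J z) = -z) (hle : ∀ (z : X) (s : ℝ), ‖z‖ ≤ ‖z + s • J z‖) (x y : X) :
    ‖x + y‖ ^ 2 + ‖x - y‖ ^ 2 = 2 * ‖x‖ ^ 2 + 2 * ‖y‖ ^ 2 := by
  have := nontrivial_of_finrank_two hdim
  obtain ⟨e, he⟩ := exists_ne (0 : X)
  have hind : ∀ s t : ℝ, s • e + t • J e = 0 → s = 0 ∧ t = 0 := by
    intro s t hst
    have h1 : s • J e - t • e = 0 := by simpa [hJ, sub_eq_add_neg] using congrArg J hst
    have h2 : (s ^ 2 + t ^ 2) • e = 0 := by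
      have : (s ^ 2 + t ^ 2) • e = s • (s • e + t • J e) - t • (s • J e - t • e) := by module
      rw [this, hst, h1]; simp
    have h3 := (smul_eq_zero.1 h2).resolve_right he
    constructor <;> nlinarith [sq_nonneg s, sq_nonneg t]
  have hnorm : ∀ a b : ℝ, ‖a • e + b • J e‖ ^ 2 = (a ^ 2 + b ^ 2) * ‖e‖ ^ 2 := by
    intro a b
    set z : ℂ := ⟨a, b⟩
    have ha : a = ‖z‖ * Real.cos z.arg := (Complex.norm_mul_cos_arg z).symm
    have hb : b = ‖z‖ * Real.sin z.arg := (Complex.norm_mul_sin_arg z).symm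
    have h1 : a • e + b • J e = ‖z‖ • (Real.cos z.arg • e + Real.sin z.arg • J e) := by
      rw [smul_add, smul_smul, smul_smul, ← ha, ← hb]
    rw [h1, norm_smul, norm_rotation_eq hJ hle, norm_norm, mul_pow, Complex.sq_norm,
      Complex.normSq_apply]
    ring
  obtain ⟨a, b, rfl⟩ := exists_coords hdim hind x
  obtain ⟨c, d, rfl⟩ := exists_coords hdim hind y
  have h1 : a • e + b • J e + (c • e + d • J e) = (a + c) • e + (b + d) • J e := by module
  have h2 : a • e + b • J e - (c • e + d • J e) = (a - c) • e + (b - d) • J e := by module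
  rw [h1, h2, hnorm, hnorm, hnorm, hnorm]
  ring

/-- A linear map that does not decrease the norm has determinant of absolute value at least one. -/
theorem one_le_abs_det_of_norm_le [FiniteDimensional ℝ X] [MeasurableSpace X] [BorelSpace X]
    {B : X →ₗ[ℝ] X} (hB : ∀ z, ‖z‖ ≤ ‖B z‖) : 1 ≤ |LinearMap.det B| := by
  have hker : LinearMap.ker B = ⊥ := by
    rw [LinearMap.ker_eq_bot']
    intro z hz
    simpa [hz] using hB z
  have hdet : LinearMap.det B ≠ 0 := by
    have h := (LinearEquiv.ofInjectiveEndo B (LinearMap.ker_eq_bot.1 hker)).isUnit_det'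
    exact h.ne_zero
  have h1 := Measure.addHaar_preimage_linearMap (Measure.addHaar : Measure X) hdet
    (Metric.ball 0 1)
  have h2 : (Measure.addHaar : Measure X) (B ⁻¹' Metric.ball 0 1)
      ≤ (Measure.addHaar : Measure X) (Metric.ball 0 1) := by
    refine measure_mono fun z hz => ?_
    simp only [Set.mem_preimage, mem_ball_zero_iff] at hz ⊢
    exact (hB z).trans_lt hz
  have hpos : 0 < (Measure.addHaar : Measure X) (Metric.ball 0 1) :=
    Metric.measure_ball_pos _ _ one_pos
  have hfin : (Measure.addHaar : Measure X) (Metric.ball 0 1) ≠ ⊤ := measure_ball_lt_top.ne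
  rw [h1] at h2
  have h3 : ENNReal.ofReal |(LinearMap.det B)⁻¹| ≤ 1 := by
    by_contra! hcon
    have := ENNReal.mul_lt_mul_left hpos.ne' hfin hcon
    rw [one_mul] at this
    exact absurd h2 (not_le.2 this)
  rw [ENNReal.ofReal_le_one, abs_inv] at h3
  exact (inv_le_one₀ (abs_pos.2 hdet)).1 h3

/-- If a nonzero linear map is Birkhoff orthogonal to the identity, the norm is Euclidean. -/
theorem parallelogram_of_norm_le [MeasurableSpace X] [BorelSpace X]
    (hdim : Module.finrank ℝ X = 2) {A : X →ₗ[ℝ] X}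
    (hA : A ≠ 0) (hle : ∀ (z : X) (s : ℝ), ‖z‖ ≤ ‖z + s • A z‖) (x y : X) :
    ‖x + y‖ ^ 2 + ‖x - y‖ ^ 2 = 2 * ‖x‖ ^ 2 + 2 * ‖y‖ ^ 2 := by
  have hfd : FiniteDimensional ℝ X := FiniteDimensional.of_finrank_pos (by omega)
  have := nontrivial_of_finrank_two hdim
  let b := Module.finBasisOfFinrankEq ℝ X hdim
  set M := LinearMap.toMatrix b b A with hM
  set τ := M 0 0 + M 1 1 with hτ
  set δ := M 0 0 * M 1 1 - M 0 1 * M 1 0 with hδ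
  have hdet : ∀ s : ℝ, 1 ≤ |1 + s * τ + s ^ 2 * δ| := by
    intro s
    have h1 := one_le_abs_det_of_norm_le (B := LinearMap.id + s • A) (fun z => hle z s)
    rw [← LinearMap.det_toMatrix b, map_add, map_smul, LinearMap.toMatrix_id, ← hM,
      Matrix.det_fin_two] at h1
    simp only [Matrix.add_apply, Matrix.smul_apply, Matrix.one_apply, smul_eq_mul] at h1
    norm_num at h1
    convert h1 using 2
    rw [hτ, hδ]; ring
  have hτ0 : τ = 0 := by
    by_contra hne
    have hτ2 : 0 < τ ^ 2 := by positivity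
    have hK : 0 < 1 + τ ^ 2 + |δ| := by positivity
    obtain ⟨σ, hσ0, h1, h2⟩ : ∃ σ : ℝ, 0 < σ ∧ σ * τ ^ 2 < 1 ∧ σ * |δ| < 1 := by
      refine ⟨1 / (1 + τ ^ 2 + |δ|), by positivity, ?_, ?_⟩
      · rw [one_div_mul_eq_div, div_lt_one hK]; linarith [abs_nonneg δ]
      · rw [one_div_mul_eq_div, div_lt_one hK]; linarith
    have h3 := hdet (-(σ * τ))
    have h4 : 1 + -(σ * τ) * τ + (-(σ * τ)) ^ 2 * δ = 1 - σ * τ ^ 2 * (1 - σ * δ) := by ring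
    rw [h4] at h3
    have h5 : |σ * δ| < 1 := by rwa [abs_mul, abs_of_pos hσ0]
    obtain ⟨h6, h7⟩ := abs_lt.1 h5
    have h8 : 0 < σ * τ ^ 2 * (1 - σ * δ) := by
      have : 0 < 1 - σ * δ := by linarith
      positivity
    have h9 : σ * τ ^ 2 * (1 - σ * δ) < 2 := by nlinarith
    exact absurd h3 (not_le.2 (abs_lt.2 ⟨by linarith, by linarith⟩))
  have hAA : ∀ z, A (A z) = -(δ • z) := by
    have hmat : M * M = -(δ • (1 : Matrix (Fin 2) (Fin 2) ℝ)) := by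
      have ht : M 1 1 = -M 0 0 := by linarith
      ext i j
      fin_cases i <;> fin_cases j <;>
        simp [Matrix.mul_apply, Fin.sum_univ_two, hδ, ht] <;> ring
    have hlin : A ∘ₗ A = -(δ • LinearMap.id) := by
      apply (LinearMap.toMatrix b b).injective
      rw [LinearMap.toMatrix_comp b b b, map_neg, map_smul, LinearMap.toMatrix_id, ← hM, hmat]
    intro z
    simpa using LinearMap.congr_fun hlin z
  have hδpos : 0 < δ := by
    rcases lt_trichotomy δ 0 with h | h | h
    · exfalso
      obtain ⟨z, hz⟩ := exists_ne (0 : X)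
      set s := Real.sqrt (1 / -δ)
      have hs : s ^ 2 = 1 / -δ := Real.sq_sqrt (by have := neg_pos.2 h; positivity)
      have h1 := (hle z s).trans (hle (z + s • A z) (-s))
      have h2 : z + s • A z + (-s) • A (z + s • A z) = (1 + s ^ 2 * δ) • z := by
        simp only [map_add, map_smul, hAA]; module
      have h3 : 1 + s ^ 2 * δ = 0 := by
        rw [hs, one_div, inv_neg, neg_mul, inv_mul_cancel₀ h.ne, add_neg_cancel]
      rw [h2, h3, zero_smul, norm_zero, norm_le_zero_iff] at h1
      exact hz h1
    · exfalso
      obtain ⟨v, hv⟩ : ∃ v, A v ≠ 0 := by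
        by_contra! hcon
        exact hA (LinearMap.ext hcon)
      have h1 : ∀ ε : ℝ, 0 < ε → ‖A v‖ ≤ ε * (2 * ‖v‖) := by
        intro ε hε
        have h2 := hle (A v + ε • v) (-(1 / ε))
        have h3 : A v + ε • v + (-(1 / ε)) • A (A v + ε • v) = ε • v := by
          simp only [map_add, map_smul, hAA, h, zero_smul, neg_zero, zero_add, smul_smul]
          rw [neg_mul, one_div_mul_cancel hε.ne']
          module
        rw [h3, norm_smul, Real.norm_eq_abs, abs_of_pos hε] at h2
        have h4 : ‖A v‖ ≤ ‖A v + ε • v‖ + ‖ε • v‖ := by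
          simpa using norm_sub_le (A v + ε • v) (ε • v)
        rw [norm_smul, Real.norm_eq_abs, abs_of_pos hε] at h4
        linarith
      have hpos : 0 < ‖A v‖ := norm_pos_iff.2 hv
      have h5 := h1 (‖A v‖ / (2 * ‖v‖ + 1) / 2) (by positivity)
      have h6 : ‖A v‖ / (2 * ‖v‖ + 1) / 2 * (2 * ‖v‖) < ‖A v‖ := by
        rw [div_div, div_mul_eq_mul_div, div_lt_iff₀ (by positivity)]
        nlinarith [norm_nonneg v]
      linarith
    · exact h
  have hsq : Real.sqrt δ * Real.sqrt δ = δ := Real.mul_self_sqrt hδpos.le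
  have hs0 : Real.sqrt δ ≠ 0 := (Real.sqrt_pos.2 hδpos).ne'
  refine parallelogram_of_complex_structure hdim (J := (Real.sqrt δ)⁻¹ • A) (fun z => ?_)
    (fun z s => ?_) x y
  · simp only [LinearMap.smul_apply, map_smul, hAA, smul_neg, smul_smul]
    congr 1
    have : (Real.sqrt δ)⁻¹ * ((Real.sqrt δ)⁻¹ * δ) = 1 := by
      rw [← mul_assoc, ← mul_inv, hsq, inv_mul_cancel₀ hδpos.ne']
    rw [this, one_smul]
  · rw [LinearMap.smul_apply, smul_smul]
    exact hle z _

end Euclidean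

section Parallelogram

variable {X : Type*} [NormedAddCommGroup X] [NormedSpace ℝ X]

/-- The parallelogram `0, x, y, x + y` spans a well-positioned, infinitesimally rigid complete
graph. -/
structure RigidParallelogram (x y : X) : Prop where
  left : NormSmooth x
  right : NormSmooth y
  add : NormSmooth (x + y)
  sub : NormSmooth (x - y)
  separating : Separating (normDeriv x) (normDeriv y)
  rigid : ∀ a b, normDeriv x a = 0 → normDeriv y b = 0 → normDeriv (x + y) (a + b) = 0 →
    normDeriv (x - y) (a - b) = 0 → a = 0 ∧ b = 0

/-- The norm is differentiable at every nonzero point of the lattice spanned by `x` and `y`. -/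
def LatticeSmooth (x y : X) : Prop :=
  ∀ m n : ℤ, (m ≠ 0 ∨ n ≠ 0) → NormSmooth ((m : ℝ) • x + (n : ℝ) • y)

namespace LatticeSmooth

variable {x y : X}

theorem left (h : LatticeSmooth x y) : NormSmooth x := by simpa using h 1 0 (by simp)

theorem right (h : LatticeSmooth x y) : NormSmooth y := by simpa using h 0 1 (by simp)

theorem add (h : LatticeSmooth x y) : NormSmooth (x + y) := by simpa using h 1 1 (by simp)

theorem sub (h : LatticeSmooth x y) : NormSmooth (x - y) := by
  simpa [sub_eq_add_neg] using h 1 (-1) (by simp)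

theorem symm (h : LatticeSmooth x y) : LatticeSmooth y x := fun m n hmn => by
  rw [add_comm]; exact h n m hmn.symm

theorem neg_right (h : LatticeSmooth x y) : LatticeSmooth x (-y) := fun m n hmn => by
  have := h m (-n) (by simpa using hmn)
  simpa using this

theorem add_right (h : LatticeSmooth x y) : LatticeSmooth x (x + y) := fun m n hmn => by
  have := h (m + n) n (by omega)
  convert this using 1
  push_cast
  module

theorem add_left (h : LatticeSmooth x y) : LatticeSmooth (x + y) y := by
  have := h.symm.add_right.symm
  rwa [add_comm] at this

theorem sub_left (h : LatticeSmooth x y) : LatticeSmooth (x - y) y := by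
  have := h.neg_right.add_left.neg_right
  rwa [neg_neg, ← sub_eq_add_neg] at this

end LatticeSmooth

theorem Separating.neg_right {x y : X} (h : Separating (normDeriv x) (normDeriv y)) :
    Separating (normDeriv x) (normDeriv (-y)) := fun w h1 h2 =>
  h w h1 (normDeriv_neg_apply_eq_zero.1 h2)

/-- Some nontrivial infinitesimal motion fixing the origin exists on every parallelogram. -/
def FlexibleParallelograms (X : Type*) [NormedAddCommGroup X] [NormedSpace ℝ X] : Prop :=
  ∀ x y : X, LatticeSmooth x y → Separating (normDeriv x) (normDeriv y) →
    ∃ a b, normDeriv x a = 0 ∧ normDeriv y b = 0 ∧ normDeriv (x + y) (a + b) = 0 ∧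
      normDeriv (x - y) (a - b) = 0 ∧ ¬ (a = 0 ∧ b = 0)

theorem abs_normDeriv_lt_of_separating {x y : X} (hdim : Module.finrank ℝ X = 2)
    (hx : NormSmooth x) (hy : NormSmooth y) (h : Separating (normDeriv x) (normDeriv y)) :
    |normDeriv x y| < ‖y‖ := by
  by_contra! hcon
  refine (not_separating_iff hdim hx hy).2 ?_ h
  rcases abs_cases (normDeriv x y) with hc | hc
  · left
    exact normDeriv_eq_of_apply_eq hy (le_antisymm (normDeriv_le _ _) (by linarith))
  · right
    rw [← neg_eq_iff_eq_neg, ← normDeriv_neg]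
    refine normDeriv_eq_of_apply_eq hy.neg (le_antisymm (normDeriv_le _ _) ?_)
    rw [map_neg, norm_neg]
    linarith

section

variable (hdim : Module.finrank ℝ X = 2) (hflex : FlexibleParallelograms X)
include hdim hflex

theorem normDeriv_sub_eq_of_add_eq {x y : X} (hl : LatticeSmooth x y)
    (hs : Separating (normDeriv x) (normDeriv y)) (h : normDeriv (x + y) = normDeriv x) :
    normDeriv (x - y) = normDeriv x := by
  obtain ⟨a, b, h1, h2, h3, h4, h5⟩ := hflex x y hl hs
  have hb : b = 0 := by
    refine hs b ?_ h2
    rw [h, map_add, h1, zero_add] at h3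
    exact h3
  subst hb
  have ha : a ≠ 0 := fun ha => h5 ⟨ha, rfl⟩
  rw [sub_zero] at h4
  rcases normDeriv_eq_or_eq_neg hdim hl.left hl.sub ha h1 h4 with h6 | h6
  · exact h6
  · exfalso
    have h7 := normDeriv_self hl.sub
    rw [h6, neg_apply, map_sub, normDeriv_self hl.left] at h7
    have h8 := abs_normDeriv_lt_of_separating hdim hl.left hl.right hs
    have h9 := norm_sub_norm_le y x
    rw [norm_sub_rev] at h9
    linarith [le_abs_self (normDeriv x y)]

theorem normDeriv_sub_nsmul_eq {y : X} (n : ℕ) : ∀ x : X, LatticeSmooth x y →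
    Separating (normDeriv x) (normDeriv y) → normDeriv (x + y) = normDeriv x →
    normDeriv (x - (n : ℝ) • y) = normDeriv x ∧ NormSmooth (x - (n : ℝ) • y) := by
  induction n with
  | zero => intro x hl _ _; simpa using hl.left
  | succ n ih =>
    intro x hl hs h
    have h1 := normDeriv_sub_eq_of_add_eq hdim hflex hl hs h
    have h2 := ih (x - y) hl.sub_left (h1 ▸ hs) (by rw [sub_add_cancel, h1])
    have h3 : x - ((n + 1 : ℕ) : ℝ) • y = x - y - (n : ℝ) • y := by push_cast; module
    rw [h3, ← h1]
    exact h2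

theorem separating_add_right {x y : X} (hl : LatticeSmooth x y)
    (hs : Separating (normDeriv x) (normDeriv y)) :
    Separating (normDeriv x) (normDeriv (x + y)) := by
  by_contra hcon
  have hlt := abs_normDeriv_lt_of_separating hdim hl.left hl.right hs
  rcases (not_separating_iff hdim hl.left hl.add).1 hcon with h | h
  · have hn : ∀ n : ℕ, (n : ℝ) * (‖y‖ + normDeriv x y) ≤ 2 * ‖x‖ := by
      intro n
      obtain ⟨h1, h2⟩ := normDeriv_sub_nsmul_eq hdim hflex n x hl hs h
      have h3 := normDeriv_self h2
      rw [h1, map_sub, map_smul, normDeriv_self hl.left, smul_eq_mul] at h3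
      have h4 := norm_sub_norm_le ((n : ℝ) • y) x
      rw [norm_sub_rev, norm_smul, Real.norm_natCast] at h4
      linarith
    have hpos : 0 < ‖y‖ + normDeriv x y := by
      linarith [neg_abs_le (normDeriv x y)]
    obtain ⟨n, hn'⟩ := exists_nat_gt (2 * ‖x‖ / (‖y‖ + normDeriv x y))
    rw [div_lt_iff₀ hpos] at hn'
    linarith [hn n]
  · have h1 := normDeriv_self hl.add
    rw [h, neg_apply, map_add, normDeriv_self hl.left] at h1
    have h2 := norm_sub_norm_le y (-x)
    rw [sub_neg_eq_add, add_comm y x, norm_neg] at h2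
    linarith [neg_abs_le (normDeriv x y)]

theorem normDeriv_add_apply_eq_zero {A : X →ₗ[ℝ] X} {x y : X} (hl : LatticeSmooth x y)
    (hs : Separating (normDeriv x) (normDeriv y)) (hx : normDeriv x (A x) = 0)
    (hy : normDeriv y (A y) = 0) (hxy : normDeriv (x - y) (A (x - y)) = 0) :
    normDeriv (x + y) (A (x + y)) = 0 := by
  obtain ⟨a, b, h1, h2, h3, h4, h5⟩ := hflex x y hl hs
  have hs1 : Separating (normDeriv x) (normDeriv (x - y)) := by
    simpa [sub_eq_add_neg] using separating_add_right hdim hflex hl.neg_right hs.neg_right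
  have hs2 : Separating (normDeriv y) (normDeriv (x - y)) := by
    have := (separating_add_right hdim hflex hl.symm.neg_right hs.symm.neg_right).neg_right
    simpa [sub_eq_add_neg] using this
  obtain ⟨c, hac, hbc⟩ : ∃ c : ℝ, A x = c • a ∧ A y = c • b := by
    by_cases ha : a = 0
    · have hb : b ≠ 0 := fun hb => h5 ⟨ha, hb⟩
      subst ha
      obtain ⟨c, hc⟩ := exists_smul_eq_of_apply_eq_zero hdim (normDeriv_ne_zero hdim hl.right)
        h2 hb hy
      refine ⟨c, ?_, hc⟩
      rw [smul_zero]
      refine hs1 _ hx ?_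
      rw [map_sub, hc, map_sub, map_smul] at hxy
      rw [zero_sub, map_neg, neg_eq_zero] at h4
      simpa [h4] using hxy
    · obtain ⟨c, hc⟩ := exists_smul_eq_of_apply_eq_zero hdim (normDeriv_ne_zero hdim hl.left)
        h1 ha hx
      refine ⟨c, hc, ?_⟩
      refine sub_eq_zero.1 (hs2 _ ?_ ?_)
      · simp [hy, h2]
      · have h6 : A y - c • b = c • (a - b) - A (x - y) := by rw [map_sub, hc]; module
        rw [h6, map_sub, map_smul, h4, hxy, smul_zero, sub_zero]
  rw [map_add, hac, hbc, ← smul_add, map_smul, h3, smul_zero]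

theorem normDeriv_nat_lattice_apply_eq_zero {A : X →ₗ[ℝ] X} (N : ℕ) : ∀ x y : X,
    LatticeSmooth x y → Separating (normDeriv x) (normDeriv y) → normDeriv x (A x) = 0 →
    normDeriv y (A y) = 0 → normDeriv (x - y) (A (x - y)) = 0 → ∀ m n : ℕ, m + n ≤ N →
    normDeriv ((m : ℝ) • x + (n : ℝ) • y) (A ((m : ℝ) • x + (n : ℝ) • y)) = 0 := by
  have hsmul : ∀ (n : ℕ) (x : X), normDeriv x (A x) = 0 →
      normDeriv ((n : ℝ) • x) (A ((n : ℝ) • x)) = 0 := by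
    intro n x hx
    rcases Nat.eq_zero_or_pos n with rfl | hn
    · simp
    · rw [normDeriv_smul_apply_eq_zero (by positivity), map_smul, map_smul, hx, smul_zero]
  induction N with
  | zero =>
    intro x y _ _ _ _ _ m n hmn
    obtain ⟨rfl, rfl⟩ : m = 0 ∧ n = 0 := by omega
    simp
  | succ N ih =>
    intro x y hl hs hx hy hxy m n hmn
    have hadd := normDeriv_add_apply_eq_zero hdim hflex hl hs hx hy hxy
    rcases Nat.eq_zero_or_pos m with rfl | hm
    · simpa using hsmul n y hy
    rcases Nat.eq_zero_or_pos n with rfl | hn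
    · simpa using hsmul m x hx
    rcases le_total n m with hnm | hnm
    · have h1 := ih x (x + y) hl.add_right (separating_add_right hdim hflex hl hs) hx hadd
        (by
          have : x - (x + y) = -y := by abel
          rw [this, normDeriv_neg_apply_eq_zero, map_neg, map_neg, hy, neg_zero])
        (m - n) n (by omega)
      have h2 : ((m - n : ℕ) : ℝ) • x + (n : ℝ) • (x + y) = (m : ℝ) • x + (n : ℝ) • y := by
        rw [Nat.cast_sub hnm]; module
      rwa [h2] at h1
    · have hs' : Separating (normDeriv (x + y)) (normDeriv y) := by
        have := separating_add_right hdim hflex hl.symm hs.symm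
        rw [add_comm] at this
        exact this.symm
      have h1 := ih (x + y) y hl.add_left hs' hadd hy
        (by rwa [add_sub_cancel_right]) m (n - m) (by omega)
      have h2 : (m : ℝ) • (x + y) + ((n - m : ℕ) : ℝ) • y = (m : ℝ) • x + (n : ℝ) • y := by
        rw [Nat.cast_sub hnm]; module
      rwa [h2] at h1

theorem normDeriv_int_lattice_apply_eq_zero {A : X →ₗ[ℝ] X} {x y : X}
    (hl : LatticeSmooth x y) (hs : Separating (normDeriv x) (normDeriv y))
    (hx : normDeriv x (A x) = 0) (hy : normDeriv y (A y) = 0)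
    (hxy : normDeriv (x - y) (A (x - y)) = 0) (m n : ℤ) :
    normDeriv ((m : ℝ) • x + (n : ℝ) • y) (A ((m : ℝ) • x + (n : ℝ) • y)) = 0 := by
  have hadd := normDeriv_add_apply_eq_zero hdim hflex hl hs hx hy hxy
  have h1 := fun m n : ℕ => normDeriv_nat_lattice_apply_eq_zero hdim hflex (m + n) x y hl hs
    hx hy hxy m n le_rfl
  have h2 := fun m n : ℕ => normDeriv_nat_lattice_apply_eq_zero hdim hflex (m + n) x (-y)
    hl.neg_right hs.neg_right hx
    (by rw [normDeriv_neg_apply_eq_zero, map_neg, map_neg, hy, neg_zero])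
    (by rwa [sub_neg_eq_add]) m n le_rfl
  have hneg : ∀ z : X, normDeriv z (A z) = 0 → normDeriv (-z) (A (-z)) = 0 := by
    intro z hz
    rw [normDeriv_neg_apply_eq_zero, map_neg, map_neg, hz, neg_zero]
  obtain ⟨k, rfl | rfl⟩ := m.eq_nat_or_neg <;> obtain ⟨l, rfl | rfl⟩ := n.eq_nat_or_neg
  · simpa only [Int.cast_natCast] using h1 k l
  · have h3 := h2 k l
    have h4 : ((k : ℤ) : ℝ) • x + ((-(l : ℤ) : ℤ) : ℝ) • y = (k : ℝ) • x + (l : ℝ) • -y := by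
      push_cast; module
    rwa [h4]
  · have h3 := hneg _ (h2 k l)
    have h4 : ((-(k : ℤ) : ℤ) : ℝ) • x + ((l : ℤ) : ℝ) • y
        = -((k : ℝ) • x + (l : ℝ) • -y) := by
      push_cast; module
    rwa [h4]
  · have h3 := hneg _ (h1 k l)
    have h4 : ((-(k : ℤ) : ℤ) : ℝ) • x + ((-(l : ℤ) : ℤ) : ℝ) • y
        = -((k : ℝ) • x + (l : ℝ) • y) := by
      push_cast; module
    rwa [h4]

theorem norm_le_of_flexible {A : X →ₗ[ℝ] X} {x y : X}
    (hl : LatticeSmooth x y) (hs : Separating (normDeriv x) (normDeriv y))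
    (hx : normDeriv x (A x) = 0) (hy : normDeriv y (A y) = 0)
    (hxy : normDeriv (x - y) (A (x - y)) = 0) (z : X) (s : ℝ) : ‖z‖ ≤ ‖z + s • A z‖ := by
  have hfd : FiniteDimensional ℝ X := FiniteDimensional.of_finrank_pos (by omega)
  have hAc : Continuous A := A.continuous_of_finiteDimensional
  have hlattice : ∀ m n : ℤ, ‖(m : ℝ) • x + (n : ℝ) • y‖
      ≤ ‖(m : ℝ) • x + (n : ℝ) • y + s • A ((m : ℝ) • x + (n : ℝ) • y)‖ := by
    intro m n
    by_cases hmn : m ≠ 0 ∨ n ≠ 0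
    · have h1 := normDeriv_int_lattice_apply_eq_zero hdim hflex hl hs hx hy hxy m n
      have h2 := normDeriv_self (hl m n hmn)
      generalize (m : ℝ) • x + (n : ℝ) • y = w at h1 h2
      have h3 := normDeriv_le w (w + s • A w)
      rwa [map_add, map_smul, h1, h2, smul_zero, add_zero] at h3
    · push Not at hmn
      obtain ⟨rfl, rfl⟩ := hmn
      simp
  have hrat : ∀ q r : ℚ, ‖(q : ℝ) • x + (r : ℝ) • y‖
      ≤ ‖(q : ℝ) • x + (r : ℝ) • y + s • A ((q : ℝ) • x + (r : ℝ) • y)‖ := by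
    intro q r
    set d : ℝ := (q.den : ℝ) * r.den
    have hq0 : (q.den : ℝ) ≠ 0 := by exact_mod_cast q.den_nz
    have hr0 : (r.den : ℝ) ≠ 0 := by exact_mod_cast r.den_nz
    have hd : 0 < d := by have := q.den_pos; have := r.den_pos; positivity
    have hq : (q : ℝ) * q.den = q.num := by exact_mod_cast q.mul_den_eq_num
    have hr : (r : ℝ) * r.den = r.num := by exact_mod_cast r.mul_den_eq_num
    have h1 := hlattice (q.num * r.den) (r.num * q.den)
    have h2 : ((q.num * r.den : ℤ) : ℝ) • x + ((r.num * q.den : ℤ) : ℝ) • y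
        = d • ((q : ℝ) • x + (r : ℝ) • y) := by
      push_cast
      rw [← hq, ← hr]
      module
    rw [h2, map_smul, smul_comm s d, ← smul_add, norm_smul, norm_smul] at h1
    exact le_of_mul_le_mul_left h1 (norm_pos_iff.2 hd.ne')
  obtain ⟨a, b, rfl⟩ := exists_coords hdim (hs.linearIndependent hdim hl.left hl.right) z
  have hclosed : IsClosed {t : ℝ × ℝ | ‖t.1 • x + t.2 • y‖
      ≤ ‖t.1 • x + t.2 • y + s • A (t.1 • x + t.2 • y)‖} :=
    isClosed_le (by fun_prop) (by fun_prop)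
  have hdense : DenseRange (Prod.map ((↑) : ℚ → ℝ) ((↑) : ℚ → ℝ)) :=
    Rat.denseRange_cast.prodMap Rat.denseRange_cast
  have hsub : Set.range (Prod.map ((↑) : ℚ → ℝ) ((↑) : ℚ → ℝ)) ⊆ {t : ℝ × ℝ |
      ‖t.1 • x + t.2 • y‖ ≤ ‖t.1 • x + t.2 • y + s • A (t.1 • x + t.2 • y)‖} := by
    rintro _ ⟨⟨q, r⟩, rfl⟩
    exact hrat q r
  exact closure_minimal hsub hclosed (hdense (a, b))

end

theorem exists_latticeSmooth [MeasurableSpace X] [BorelSpace X]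
    (hdim : Module.finrank ℝ X = 2) :
    ∃ x y : X, LatticeSmooth x y ∧ Separating (normDeriv x) (normDeriv y) := by
  have hfd : FiniteDimensional ℝ X := FiniteDimensional.of_finrank_pos (by omega)
  let μ : Measure X := Measure.addHaar
  have hae : ∀ᵐ x ∂μ, NormSmooth x := ae_differentiableAt_norm
  obtain ⟨x, hx⟩ := (dense_differentiableAt_norm (E := X)).nonempty
  have hae' : ∀ᵐ y ∂μ, ∀ m n : ℤ, n ≠ 0 → NormSmooth ((m : ℝ) • x + (n : ℝ) • y) := by
    rw [ae_all_iff]; intro m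
    rw [ae_all_iff]; intro n
    by_cases hn : n = 0
    · simp [hn]
    have hnr : (n : ℝ) ≠ 0 := by exact_mod_cast hn
    have h1 : ∀ᵐ y ∂μ, NormSmooth (((m : ℝ) / n) • x + y) :=
      (measurePreserving_add_left μ (((m : ℝ) / n) • x)).quasiMeasurePreserving.ae hae
    filter_upwards [h1] with y hy _
    have := hy.smul hnr
    rwa [smul_add, smul_smul, mul_div_cancel₀ _ hnr] at this
  have hdense := Measure.dense_of_ae hae'
  obtain ⟨y, hy, hs⟩ := exists_separating hdim hx hdense
    (fun y hy => by simpa using hy 0 1 one_ne_zero)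
  refine ⟨x, y, fun m n hmn => ?_, hs⟩
  by_cases hn : n = 0
  · subst hn
    have hm : (m : ℝ) ≠ 0 := by simpa using hmn
    have hx' : NormSmooth x := hx
    simpa using hx'.smul hm
  · exact hy m n hn

/-- A non-Euclidean normed plane contains a rigid parallelogram. -/
theorem exists_rigidParallelogram [MeasurableSpace X] [BorelSpace X]
    (hdim : Module.finrank ℝ X = 2)
    (hnE : ∃ x y : X, ‖x + y‖ ^ 2 + ‖x - y‖ ^ 2 ≠ 2 * ‖x‖ ^ 2 + 2 * ‖y‖ ^ 2) :
    ∃ x y : X, RigidParallelogram x y := by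
  by_contra! hcon
  have hflex : FlexibleParallelograms X := by
    intro x y hl hs
    by_contra! h
    exact hcon x y ⟨hl.left, hl.right, hl.add, hl.sub, hs, h⟩
  obtain ⟨x, y, hl, hs⟩ := exists_latticeSmooth hdim
  obtain ⟨a, b, h1, h2, -, h4, h5⟩ := hflex x y hl hs
  have hli : LinearIndependent ℝ ![x, y] :=
    LinearIndependent.pair_iff.2 (hs.linearIndependent hdim hl.left hl.right)
  let B := basisOfLinearIndependentOfCardEqFinrank hli (by simp [hdim])
  let A : X →ₗ[ℝ] X := B.constr ℝ ![a, b]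
  have hB0 : B 0 = x := by simp [B]
  have hB1 : B 1 = y := by simp [B]
  have hAx : A x = a := by
    have := B.constr_basis ℝ ![a, b] 0
    rwa [hB0] at this
  have hAy : A y = b := by
    have := B.constr_basis ℝ ![a, b] 1
    rwa [hB1] at this
  have hA : A ≠ 0 := by
    intro hA
    exact h5 ⟨by rw [← hAx, hA]; rfl, by rw [← hAy, hA]; rfl⟩
  obtain ⟨u, v, huv⟩ := hnE
  refine huv (parallelogram_of_norm_le hdim hA (fun z s => ?_) u v)
  exact norm_le_of_flexible hdim hflex hl hs (by rwa [hAx]) (by rwa [hAy])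
    (by rwa [map_sub, hAx, hAy]) z s

end Parallelogram

section Frameworks

variable {X : Type*} [NormedAddCommGroup X] [NormedSpace ℝ X] {V : Type*}

/-- Every motion `u` annihilated along the edges in `E` by the functionals `φ` is constant
on `U`. -/
def RigidWith (φ : V → V → X →L[ℝ] ℝ) (E : Finset (Sym2 V)) (U : Finset V) : Prop :=
  ∀ u : V → X, (∀ v w, s(v, w) ∈ E → φ v w (u v - u w) = 0) → ∀ v ∈ U, ∀ w ∈ U, u v = u w

/-- The placement `p` is well-positioned with respect to the edges in `E`. -/
def WellPositioned (p : V → X) (E : Finset (Sym2 V)) : Prop :=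
  ∀ v w, s(v, w) ∈ E → NormSmooth (p v - p w)

/-- The placement `p` of the graph with vertices `U` and edges `E` is well-positioned and
infinitesimally rigid. -/
structure Realizes (p : V → X) (E : Finset (Sym2 V)) (U : Finset V) : Prop where
  wellPositioned : WellPositioned p E
  rigid : RigidWith (fun v w => normDeriv (p v - p w)) E U

theorem normDeriv_sub_comm_apply (x y a b : X) :
    normDeriv (x - y) (a - b) = normDeriv (y - x) (b - a) := by
  rw [← neg_sub y x, normDeriv_neg, ← neg_sub b a, map_neg, neg_apply, neg_neg]

theorem RigidWith.congr {φ ψ : V → V → X →L[ℝ] ℝ} {E : Finset (Sym2 V)} {U : Finset V}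
    (h : RigidWith φ E U) (hφψ : ∀ v w, s(v, w) ∈ E → φ v w = ψ v w) : RigidWith ψ E U :=
  fun u hu => h u fun v w hvw => by rw [hφψ v w hvw]; exact hu v w hvw

theorem Realizes.congr {p q : V → X} {E : Finset (Sym2 V)} {U : Finset V}
    (h : Realizes p E U) (hE : E ⊆ U.sym2) (hpq : ∀ v ∈ U, p v = q v) : Realizes q E U := by
  have hmem : ∀ v w, s(v, w) ∈ E → p v = q v ∧ p w = q w := fun v w hvw => by
    have := Finset.mk_mem_sym2_iff.1 (hE hvw)
    exact ⟨hpq v this.1, hpq w this.2⟩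
  refine ⟨fun v w hvw => ?_, h.rigid.congr fun v w hvw => ?_⟩
  · rw [← (hmem v w hvw).1, ← (hmem v w hvw).2]
    exact h.wellPositioned v w hvw
  · rw [(hmem v w hvw).1, (hmem v w hvw).2]

theorem WellPositioned.insert [DecidableEq V] {p : V → X} {E : Finset (Sym2 V)}
    (h : WellPositioned p E) {a b : V} (hab : NormSmooth (p a - p b)) :
    WellPositioned p (insert s(a, b) E) := by
  intro v w hvw
  rcases Finset.mem_insert.1 hvw with h1 | h1
  · rcases Sym2.eq_iff.1 h1 with ⟨rfl, rfl⟩ | ⟨rfl, rfl⟩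
    · exact hab
    · exact normSmooth_sub_comm.1 hab
  · exact h v w h1

theorem WellPositioned.ne [Nontrivial X] {p : V → X} {E : Finset (Sym2 V)}
    (h : WellPositioned p E) {v w : V} (hvw : s(v, w) ∈ E) : v ≠ w := by
  rintro rfl
  exact (h v v hvw).ne_zero (sub_self _)

theorem RigidWith.eventually [Finite V] [FiniteDimensional ℝ X] {φ : V → V → X →L[ℝ] ℝ}
    {E : Finset (Sym2 V)} {U : Finset V} (h : RigidWith φ E U) (hE : E ⊆ U.sym2) :
    ∀ᶠ ψ in 𝓝 φ, RigidWith ψ E U := by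
  classical
  have := Fintype.ofFinite V
  rcases U.eq_empty_or_nonempty with rfl | ⟨v₀, hv₀⟩
  · exact Eventually.of_forall fun ψ u _ v hv => absurd hv (Finset.notMem_empty v)
  let L : (V → V → X →L[ℝ] ℝ) → (V → X) →L[ℝ] (V → X) × (V → V → ℝ) := fun ψ =>
    (ContinuousLinearMap.pi fun v => if v ∈ U ∧ v ≠ v₀ then 0 else
      ContinuousLinearMap.proj (R := ℝ) (φ := fun _ : V => X) v).prod
    (ContinuousLinearMap.pi fun v => ContinuousLinearMap.pi fun w => if s(v, w) ∈ E then
      (ψ v w).comp (ContinuousLinearMap.proj (R := ℝ) (φ := fun _ : V => X) v -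
        ContinuousLinearMap.proj (R := ℝ) (φ := fun _ : V => X) w) else 0)
  have hL1 : ∀ ψ u v, (L ψ u).1 v = if v ∈ U ∧ v ≠ v₀ then 0 else u v := by
    intro ψ u v
    simp only [L, ContinuousLinearMap.prod_apply, ContinuousLinearMap.pi_apply]
    split_ifs <;> simp
  have hL2 : ∀ ψ u v w, (L ψ u).2 v w = if s(v, w) ∈ E then ψ v w (u v - u w) else 0 := by
    intro ψ u v w
    simp only [L, ContinuousLinearMap.prod_apply, ContinuousLinearMap.pi_apply]
    split_ifs <;> simp
  have hLc : Continuous L := by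
    rw [continuous_clm_apply]
    intro u
    refine Continuous.prodMk (continuous_pi fun v => ?_)
      (continuous_pi fun v => continuous_pi fun w => ?_)
    · change Continuous fun ψ => (L ψ u).1 v
      simp only [hL1]
      exact continuous_const
    · change Continuous fun ψ => (L ψ u).2 v w
      simp only [hL2]
      split_ifs
      · fun_prop
      · exact continuous_const
  have hinj : Function.Injective (L φ) := by
    rw [injective_iff_map_eq_zero]
    intro u hu
    have h1 : ∀ v, (if v ∈ U ∧ v ≠ v₀ then 0 else u v) = 0 := fun v => by
      rw [← hL1 φ, hu]; rfl
    have h2 := h u fun v w hvw => by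
      have := hL2 φ u v w
      rw [if_pos hvw, hu] at this
      exact this.symm
    have h3 : u v₀ = 0 := by simpa using h1 v₀
    funext v
    by_cases hv : v ∈ U
    · rw [h2 v hv v₀ hv₀, h3]; rfl
    · simpa [hv] using h1 v
  have hopen : ∀ᶠ ψ in 𝓝 φ, Function.Injective (L ψ) :=
    hLc.continuousAt.eventually (ContinuousLinearMap.isOpen_injective.mem_nhds hinj)
  filter_upwards [hopen] with ψ hψ u hu
  suffices hz : (fun v => if v ∈ U then u v - u v₀ else 0) = 0 by
    have h4 : ∀ v ∈ U, u v = u v₀ := fun v hv => by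
      have := congrFun hz v
      simp only [hv, if_true] at this
      exact sub_eq_zero.1 this
    exact fun v hv w hw => (h4 v hv).trans (h4 w hw).symm
  refine (injective_iff_map_eq_zero _).1 hψ _ (Prod.ext (funext fun v => ?_)
    (funext fun v => funext fun w => ?_))
  · rw [hL1]
    by_cases hv : v ∈ U <;> by_cases hv' : v = v₀ <;> simp [hv, hv']
  · rw [hL2]
    split_ifs with hvw hv hw hw
    · simpa using hu v w hvw
    · exact absurd (Finset.mk_mem_sym2_iff.1 (hE hvw)).2 hw
    · exact absurd (Finset.mk_mem_sym2_iff.1 (hE hvw)).1 hv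
    · simp
    · rfl

theorem RigidWith.eventually_normDeriv [Finite V] [FiniteDimensional ℝ X] {ι : Type*}
    {l : Filter ι} {P : ι → V → X} {φ : V → V → X →L[ℝ] ℝ} {E : Finset (Sym2 V)} {U : Finset V}
    (h : RigidWith φ E U) (hE : E ⊆ U.sym2)
    (ht : ∀ v w, s(v, w) ∈ E → Tendsto (fun i => normDeriv (P i v - P i w)) l (𝓝 (φ v w))) :
    ∀ᶠ i in l, RigidWith (fun v w => normDeriv (P i v - P i w)) E U := by
  classical
  have := Fintype.ofFinite V
  let ψ : ι → V → V → X →L[ℝ] ℝ := fun i v w =>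
    if s(v, w) ∈ E then normDeriv (P i v - P i w) else φ v w
  have hψ : Tendsto ψ l (𝓝 φ) := by
    rw [tendsto_pi_nhds]; intro v
    rw [tendsto_pi_nhds]; intro w
    by_cases hvw : s(v, w) ∈ E
    · simpa [ψ, hvw] using ht v w hvw
    · simpa [ψ, hvw] using tendsto_const_nhds
  filter_upwards [hψ.eventually (h.eventually hE)] with i hi
  exact hi.congr fun v w hvw => by simp [ψ, hvw]

theorem tendsto_normDeriv {ι : Type*} {l : Filter ι} {f : ι → X} {x : X} (hx : NormSmooth x)
    (hf : Tendsto f l (𝓝 x)) (hs : ∀ᶠ i in l, NormSmooth (f i)) :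
    Tendsto (fun i => normDeriv (f i)) l (𝓝 (normDeriv x)) :=
  (continuousWithinAt_normDeriv hx).tendsto.comp (tendsto_nhdsWithin_iff.2 ⟨hf, hs⟩)

section Measure

variable [FiniteDimensional ℝ X] [MeasurableSpace X] [BorelSpace X]

theorem ae_normSmooth_sub (a : X) : ∀ᵐ z ∂(Measure.addHaar : Measure X), NormSmooth (z - a) :=
  (measurePreserving_sub_right Measure.addHaar a).quasiMeasurePreserving.ae
    ae_differentiableAt_norm

theorem ae_sub_ne_smul (hdim : Module.finrank ℝ X = 2) (a x : X) :
    ∀ᵐ z ∂(Measure.addHaar : Measure X), ∀ t : ℝ, z - a ≠ t • x := by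
  have hne : Submodule.span ℝ {x} ≠ ⊤ := by
    intro h
    have h1 := finrank_span_le_card (R := ℝ) ({x} : Set X)
    rw [h, finrank_top, hdim] at h1
    simp at h1
  have h2 : ∀ᵐ z ∂(Measure.addHaar : Measure X), z ∉ (Submodule.span ℝ {x} : Set X) :=
    measure_eq_zero_iff_ae_notMem.1 (Measure.addHaar_submodule _ _ hne)
  filter_upwards [(measurePreserving_sub_right Measure.addHaar a).quasiMeasurePreserving.ae h2]
    with z hz t ht
  exact hz (ht ▸ Submodule.smul_mem _ t (Submodule.mem_span_singleton_self x))

theorem exists_of_eventually_of_ae {x : X} {P Q : X → Prop} (hP : ∀ᶠ z in 𝓝 x, P z)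
    (hQ : ∀ᵐ z ∂(Measure.addHaar : Measure X), Q z) : ∃ z, P z ∧ Q z := by
  obtain ⟨z, hz, hQz⟩ := (Measure.dense_of_ae hQ).inter_nhds_nonempty hP
  exact ⟨z, hQz, hz⟩

theorem Realizes.exists_update [Finite V] [DecidableEq V] {p : V → X} {E : Finset (Sym2 V)}
    {U : Finset V} (h : Realizes p E U) (hE : E ⊆ U.sym2) [Nontrivial X] (c : V) {N : X → Prop}
    (hN : ∀ᵐ z ∂(Measure.addHaar : Measure X), N z) :
    ∃ z, N z ∧ Realizes (Function.update p c z) E U := by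
  have := Fintype.ofFinite V
  have hG : ∀ᵐ z ∂(Measure.addHaar : Measure X), WellPositioned (Function.update p c z) E := by
    unfold WellPositioned
    rw [ae_all_iff]; intro v
    rw [ae_all_iff]; intro w
    by_cases hvw : s(v, w) ∈ E
    · have hne := h.wellPositioned.ne hvw
      by_cases hv : v = c
      · subst hv
        filter_upwards [ae_normSmooth_sub (p w)] with z hz _
        simpa [hne.symm] using hz
      · by_cases hw : w = c
        · subst hw
          filter_upwards [ae_normSmooth_sub (p v)] with z hz _
          simpa [hv] using normSmooth_sub_comm.1 hz
        · filter_upwards with z _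
          simpa [hv, hw] using h.wellPositioned v w hvw
    · simp [hvw]
  have hR : ∀ᶠ z in 𝓝 (p c) ⊓ 𝓟 {z | WellPositioned (Function.update p c z) E},
      RigidWith (fun v w => normDeriv (Function.update p c z v - Function.update p c z w)) E U := by
    refine h.rigid.eventually_normDeriv hE fun v w hvw => ?_
    refine tendsto_normDeriv (h.wellPositioned v w hvw) ?_ ?_
    · have hc : Continuous fun z => Function.update p c z v - Function.update p c z w := by
        have : Continuous fun z => Function.update p c z :=
          continuous_const.update c continuous_id
        fun_prop
      have := hc.tendsto (p c)
      simp only [Function.update_eq_self] at this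
      exact this.mono_left inf_le_left
    · filter_upwards [mem_inf_of_right (mem_principal_self _)] with z hz
      exact hz v w hvw
  rw [eventually_inf_principal] at hR
  obtain ⟨z, h1, h2, h3⟩ := exists_of_eventually_of_ae hR (hG.and hN)
  exact ⟨z, h3, h2, h1 h2⟩

omit [MeasurableSpace X] [BorelSpace X] in
theorem exists_smooth_separating (hdim : Module.finrank ℝ X = 2) {x : X} (hx : NormSmooth x) :
    ∃ y, NormSmooth y ∧ Separating (normDeriv x) (normDeriv y) :=
  exists_separating hdim hx dense_differentiableAt_norm fun _ h => h

theorem Realizes.zero_extension [Finite V] [DecidableEq V] (hdim : Module.finrank ℝ X = 2)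
    {p : V → X} {E : Finset (Sym2 V)} {U : Finset V} (h : Realizes p E U) (hE : E ⊆ U.sym2)
    {v a b : V} (hv : v ∉ U) (ha : a ∈ U) (hb : b ∈ U) (hab : a ≠ b) :
    ∃ q : V → X, Realizes q (insert s(v, a) (insert s(v, b) E)) (insert v U) := by
  have := nontrivial_of_finrank_two hdim
  obtain ⟨x, hx⟩ := (dense_differentiableAt_norm (E := X)).nonempty
  obtain ⟨y, hy, hxy⟩ := exists_smooth_separating hdim hx
  obtain ⟨z, ⟨hzx, hzy⟩, hp⟩ := h.exists_update hE a
    ((ae_sub_ne_smul hdim (p b) x).and (ae_sub_ne_smul hdim (p b) y))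
  set p₁ := Function.update p a z with hp₁
  have hp₁a : p₁ a = z := by simp [hp₁]
  have hp₁b : p₁ b = p b := by simp [hp₁, hab.symm]
  obtain ⟨α, β, hαβ⟩ := exists_coords hdim (hxy.linearIndependent hdim hx hy) (z - p b)
  have hα : α ≠ 0 := fun h0 => hzy β (by simpa [h0] using hαβ)
  have hβ : β ≠ 0 := fun h0 => hzx α (by simpa [h0] using hαβ)
  set q := Function.update p₁ v (p b + α • x) with hq
  have hva : v ≠ a := fun h0 => hv (h0 ▸ ha)
  have hvb : v ≠ b := fun h0 => hv (h0 ▸ hb)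
  have hqU : ∀ w ∈ U, p₁ w = q w := fun w hw => by
    have : w ≠ v := fun h0 => hv (h0 ▸ hw)
    simp [hq, this]
  have hqb : q v - q b = α • x := by
    rw [← hqU b hb, hp₁b]; simp [hq]
  have hqa : q v - q a = (-β) • y := by
    rw [← hqU a ha, hp₁a]
    have hz : z = p b + (α • x + β • y) := by rw [← hαβ]; abel
    simp only [hq, Function.update_self, hz]
    module
  have hp' := hp.congr hE hqU
  refine ⟨q, (hp'.wellPositioned.insert ?_).insert ?_, fun u hu => ?_⟩
  · rw [hqb]; exact NormSmooth.smul hx hα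
  · rw [hqa]; exact hy.smul (neg_ne_zero.2 hβ)
  · have hU := hp'.rigid u fun v' w' h' => hu v' w' (by simp [h'])
    have h1 := hu v a (by simp)
    have h2 := hu v b (by simp)
    simp only [hqa, hqb] at h1 h2
    rw [normDeriv_smul_apply_eq_zero (neg_ne_zero.2 hβ)] at h1
    rw [normDeriv_smul_apply_eq_zero hα, ← hU a ha b hb] at h2
    have hva : u v = u a := sub_eq_zero.1 (hxy _ h2 h1)
    have hall : ∀ w ∈ insert v U, u w = u a := by
      intro w hw
      rcases Finset.mem_insert.1 hw with rfl | hw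
      · exact hva
      · exact hU w hw a ha
    exact fun w hw w' hw' => (hall w hw).trans (hall w' hw').symm

theorem Realizes.one_extension [Finite V] [DecidableEq V] (hdim : Module.finrank ℝ X = 2)
    {p : V → X} {E : Finset (Sym2 V)} {U : Finset V} {v a b c : V}
    (h : Realizes p (insert s(a, b) E) U) (hE : insert s(a, b) E ⊆ U.sym2)
    (hv : v ∉ U) (hc : c ∈ U) (hca : c ≠ a) (hcb : c ≠ b) :
    ∃ q : V → X, Realizes q (insert s(v, a) (insert s(v, b) (insert s(v, c) E)))
      (insert v U) := by
  have := nontrivial_of_finrank_two hdim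
  obtain ⟨ha, hb⟩ := Finset.mk_mem_sym2_iff.1 (hE (Finset.mem_insert_self _ _))
  have hd : NormSmooth (p b - p a) :=
    normSmooth_sub_comm.1 (h.wellPositioned a b (Finset.mem_insert_self _ _))
  set d := p b - p a with hd'
  obtain ⟨x, hx, hdx⟩ := exists_smooth_separating hdim hd
  obtain ⟨z, ⟨hzd, hzx, hzx'⟩, hp⟩ := h.exists_update hE c
    ((ae_sub_ne_smul hdim (p a) d).and
      ((ae_sub_ne_smul hdim (p a) x).and (ae_sub_ne_smul hdim (p b) x)))
  set p₁ := Function.update p c z with hp₁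
  have hp₁a : p₁ a = p a := by simp [hp₁, hca.symm]
  have hp₁b : p₁ b = p b := by simp [hp₁, hcb.symm]
  have hp₁c : p₁ c = z := by simp [hp₁]
  obtain ⟨α, β, hαβ⟩ := exists_coords hdim (hdx.linearIndependent hdim hd hx) (z - p a)
  have hz : z = p a + (α • d + β • x) := by rw [← hαβ]; abel
  have hpb : p b = p a + d := by rw [hd']; abel
  have hα : α ≠ 0 := fun h0 => hzx β (by simpa [h0] using hαβ)
  have hβ : β ≠ 0 := fun h0 => hzd α (by simpa [h0] using hαβ)
  have hα' : α - 1 ≠ 0 := fun h0 => hzx' β (by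
    have h1 : α = 1 := by linarith
    rw [hz, hpb, h1]; module)
  set q := Function.update p₁ v (p a + α • d) with hq
  have hqU : ∀ w ∈ U, p₁ w = q w := fun w hw => by
    have : w ≠ v := fun h0 => hv (h0 ▸ hw)
    simp [hq, this]
  have hqa : q v - q a = α • d := by
    rw [← hqU a ha, hp₁a]; simp [hq]
  have hqb : q v - q b = (α - 1) • d := by
    rw [← hqU b hb, hp₁b, hpb]; simp only [hq, Function.update_self]; module
  have hqc : q v - q c = (-β) • x := by
    rw [← hqU c hc, hp₁c, hz]; simp only [hq, Function.update_self]; module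
  have hqab : q a - q b = (-1 : ℝ) • d := by
    rw [← hqU a ha, ← hqU b hb, hp₁a, hp₁b, hpb]; module
  have hp' := hp.congr hE hqU
  have hwp : WellPositioned q E := fun v' w' h' =>
    hp'.wellPositioned v' w' (Finset.mem_insert_of_mem h')
  refine ⟨q, ((hwp.insert ?_).insert ?_).insert ?_, fun u hu => ?_⟩
  · rw [hqc]; exact hx.smul (neg_ne_zero.2 hβ)
  · rw [hqb]; exact hd.smul hα'
  · rw [hqa]; exact hd.smul hα
  · have h1 := hu v a (by simp)
    have h2 := hu v b (by simp)
    have h3 := hu v c (by simp)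
    simp only [hqa, hqb, hqc] at h1 h2 h3
    rw [normDeriv_smul_apply_eq_zero hα] at h1
    rw [normDeriv_smul_apply_eq_zero hα'] at h2
    rw [normDeriv_smul_apply_eq_zero (neg_ne_zero.2 hβ)] at h3
    have h4 : normDeriv d (u a - u b) = 0 := by
      have : u a - u b = (u v - u b) - (u v - u a) := by abel
      rw [this, map_sub, h1, h2, sub_zero]
    have hab : normDeriv (q a - q b) (u a - u b) = 0 := by
      rw [hqab, normDeriv_smul_apply_eq_zero (by norm_num), h4]
    have hU := hp'.rigid u fun v' w' h' => by
      rcases Finset.mem_insert.1 h' with h'' | h''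
      · rcases Sym2.eq_iff.1 h'' with ⟨rfl, rfl⟩ | ⟨rfl, rfl⟩
        · exact hab
        · exact (normDeriv_sub_comm_apply _ _ _ _).trans hab
      · exact hu v' w' (by simp [h''])
    rw [← hU a ha c hc] at h3
    have hva : u v = u a := sub_eq_zero.1 (hdx _ h1 h3)
    have hall : ∀ w ∈ insert v U, u w = u a := by
      intro w hw
      rcases Finset.mem_insert.1 hw with rfl | hw
      · exact hva
      · exact hU w hw a ha
    exact fun w hw w' hw' => (hall w hw).trans (hall w' hw').symm

omit [FiniteDimensional ℝ X] [MeasurableSpace X] [BorelSpace X] in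
theorem RigidParallelogram.exists_realizes [DecidableEq V] {x y : X}
    (h : RigidParallelogram x y) {v a b c : V} (hva : v ≠ a) (hvb : v ≠ b) (hvc : v ≠ c)
    (hab : a ≠ b) (hac : a ≠ c) (hbc : b ≠ c) :
    ∃ q : V → X, Realizes q {s(v, a), s(v, b), s(v, c), s(a, b), s(a, c), s(b, c)}
      {v, a, b, c} := by
  let q : V → X := fun w => if w = v then 0 else if w = a then x else if w = b then y else x + y
  have hqv : q v = 0 := by simp [q]
  have hqa : q a = x := by simp [q, hva.symm]
  have hqb : q b = y := by simp [q, hvb.symm, hab.symm]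
  have hqc : q c = x + y := by simp [q, hvc.symm, hac.symm, hbc.symm]
  have h1 : q v - q a = -x := by rw [hqv, hqa, zero_sub]
  have h2 : q v - q b = -y := by rw [hqv, hqb, zero_sub]
  have h3 : q v - q c = -(x + y) := by rw [hqv, hqc, zero_sub]
  have h4 : q a - q b = x - y := by rw [hqa, hqb]
  have h5 : q a - q c = -y := by rw [hqa, hqc]; abel
  have h6 : q b - q c = -x := by rw [hqb, hqc]; abel
  have hnil : WellPositioned q (∅ : Finset (Sym2 V)) :=
    fun _ _ h' => absurd h' (Finset.notMem_empty _)
  have hwp := (((((hnil.insert (h6 ▸ h.left.neg)).insert (h5 ▸ h.right.neg)).insert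
    (h4 ▸ h.sub)).insert (h3 ▸ h.add.neg)).insert (h2 ▸ h.right.neg)).insert (h1 ▸ h.left.neg)
  refine ⟨q, hwp, fun u hu => ?_⟩
  have e1 := hu v a (by simp)
  have e2 := hu v b (by simp)
  have e3 := hu v c (by simp)
  have e4 := hu a b (by simp)
  have e5 := hu a c (by simp)
  have e6 := hu b c (by simp)
  simp only [h1, h2, h3, h4, h5, h6, normDeriv_neg_apply_eq_zero] at e1 e2 e3 e4 e5 e6
  simp only [map_sub, sub_eq_zero] at e1 e2 e3 e4 e5 e6
  have hpar : u c - u v - (u a - u v) - (u b - u v) = 0 := by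
    refine h.separating _ ?_ ?_
    · simp only [map_sub]; linarith
    · simp only [map_sub]; linarith
  have hc : u c - u v = (u a - u v) + (u b - u v) := by
    rw [sub_sub, sub_eq_zero] at hpar
    exact hpar
  obtain ⟨ha0, hb0⟩ := h.rigid (u a - u v) (u b - u v) (by rw [map_sub]; linarith)
    (by rw [map_sub]; linarith) (by rw [← hc, map_sub]; linarith)
    (by simp only [map_sub]; linarith)
  rw [ha0, hb0, add_zero] at hc
  have hall : ∀ w ∈ ({v, a, b, c} : Finset V), u w = u v := by
    intro w hw
    simp only [Finset.mem_insert, Finset.mem_singleton] at hw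
    rcases hw with rfl | rfl | rfl | rfl
    · rfl
    · exact sub_eq_zero.1 ha0
    · exact sub_eq_zero.1 hb0
    · exact sub_eq_zero.1 hc
  exact fun w hw z hz => (hall w hw).trans (hall z hz).symm

/-- The map collapsing `W` onto the vertex `h`. -/
def collapse [DecidableEq V] (W : Finset V) (h v : V) : V := if v ∈ W then h else v

theorem Realizes.exists_of_collapse [Finite V] [DecidableEq V]
    (hdim : Module.finrank ℝ X = 2) {p₀ q : V → X} {E : Finset (Sym2 V)} {U W : Finset V} {h : V}
    (hE : E ⊆ U.sym2) (hh : h ∈ W) (hq : Realizes q (E ∩ W.sym2) W)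
    (hp₀ : Realizes p₀ ((E \ W.sym2).image (Sym2.map (collapse W h)))
      (U.image (collapse W h))) :
    ∃ p : V → X, Realizes p E U := by
  have := nontrivial_of_finrank_two hdim
  have := Fintype.ofFinite V
  set π := collapse W h with hπ
  have hπW : ∀ v ∈ W, π v = h := fun v hv => by simp [hπ, collapse, hv]
  have hπn : ∀ v, v ∉ W → π v = v := fun v hv => by simp [hπ, collapse, hv]
  have hout : ∀ v w, s(v, w) ∈ E → ¬ (v ∈ W ∧ w ∈ W) →
      s(π v, π w) ∈ (E \ W.sym2).image (Sym2.map π) := by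
    intro v w hvw hn
    refine Finset.mem_image.2 ⟨s(v, w), Finset.mem_sdiff.2 ⟨hvw, ?_⟩, rfl⟩
    rwa [Finset.mk_mem_sym2_iff]
  have hin : ∀ v w, s(v, w) ∈ E → v ∈ W ∧ w ∈ W → s(v, w) ∈ E ∩ W.sym2 := fun v w hvw hW =>
    Finset.mem_inter.2 ⟨hvw, Finset.mk_mem_sym2_iff.2 hW⟩
  let P : ℝ × X → V → X := fun i v => if v ∈ W then p₀ h + i.2 + i.1 • q v else p₀ v
  have hPc : ∀ v, Continuous fun i => P i v := by
    intro v
    by_cases hv : v ∈ W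
    · simp only [P, hv, if_true]; fun_prop
    · simp only [P, hv, if_false]; fun_prop
  have hP0 : ∀ v, P (0, 0) v = p₀ (π v) := by
    intro v
    by_cases hv : v ∈ W
    · simp [P, hv, hπW]
    · simp [P, hv, hπn]
  have hPin : ∀ i v w, v ∈ W ∧ w ∈ W → P i v - P i w = i.1 • (q v - q w) := by
    intro i v w hvw
    simp only [P, hvw.1, hvw.2, if_true]
    module
  let φ : V → V → X →L[ℝ] ℝ := fun v w =>
    if v ∈ W ∧ w ∈ W then normDeriv (q v - q w) else normDeriv (p₀ (π v) - p₀ (π w))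
  have hφ : RigidWith φ E U := by
    intro u hu
    have huW : ∀ v ∈ W, ∀ w ∈ W, u v = u w := by
      refine hq.rigid u fun v w hvw => ?_
      obtain ⟨h1, h2⟩ := Finset.mem_inter.1 hvw
      have := hu v w h1
      rw [Finset.mk_mem_sym2_iff] at h2
      simpa only [φ, if_pos h2] using this
    have huπ : ∀ v, u (π v) = u v := by
      intro v
      by_cases hv : v ∈ W
      · rw [hπW v hv]; exact huW h hh v hv
      · rw [hπn v hv]
    have hU := hp₀.rigid u fun v' w' h' => by
      obtain ⟨e, he, hee⟩ := Finset.mem_image.1 h'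
      induction e with | _ v w
      obtain ⟨h1, h2⟩ := Finset.mem_sdiff.1 he
      rw [Finset.mk_mem_sym2_iff] at h2
      have h3 := hu v w h1
      simp only [φ, if_neg h2] at h3
      rw [Sym2.map_mk] at hee
      rcases Sym2.eq_iff.1 hee with ⟨rfl, rfl⟩ | ⟨rfl, rfl⟩
      · rwa [huπ, huπ]
      · rw [huπ, huπ]
        exact (normDeriv_sub_comm_apply _ _ _ _).trans h3
    intro v hv w hw
    rw [← huπ v, ← huπ w]
    exact hU _ (Finset.mem_image_of_mem _ hv) _ (Finset.mem_image_of_mem _ hw)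
  set l : Filter (ℝ × X) := (𝓝[>] 0 ×ˢ 𝓝 0) ⊓ 𝓟 {i | WellPositioned (P i) E} with hl
  have hpos : ∀ᶠ i in l, 0 < i.1 := by
    have h1 : ∀ᶠ i in (𝓝[>] (0 : ℝ) ×ˢ 𝓝 (0 : X)), 0 < i.1 :=
      tendsto_fst.eventually self_mem_nhdsWithin
    exact h1.filter_mono inf_le_left
  have hl0 : l ≤ 𝓝 (0, 0) := by
    rw [nhds_prod_eq]
    exact inf_le_left.trans (Filter.prod_mono nhdsWithin_le_nhds le_rfl)
  have hR : ∀ᶠ i in l, RigidWith (fun v w => normDeriv (P i v - P i w)) E U := by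
    refine hφ.eventually_normDeriv hE fun v w hvw => ?_
    by_cases hW : v ∈ W ∧ w ∈ W
    · simp only [φ, if_pos hW]
      refine tendsto_const_nhds.congr' ?_
      filter_upwards [hpos] with i hi
      rw [hPin i v w hW]
      exact (fderiv_norm_smul_pos hi).symm
    · simp only [φ, if_neg hW]
      refine tendsto_normDeriv (hp₀.wellPositioned _ _ (hout v w hvw hW)) ?_ ?_
      · have hc : Continuous fun i => P i v - P i w := (hPc v).sub (hPc w)
        have h1 := (hc.tendsto (0, 0)).mono_left hl0
        simpa only [hP0] using h1
      · filter_upwards [mem_inf_of_right (mem_principal_self _)] with i hi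
        exact hi v w hvw
  rw [hl, eventually_inf_principal] at hR
  obtain ⟨ε, hε, hεpos⟩ := (hR.curry.and self_mem_nhdsWithin).exists
  replace hεpos : 0 < ε := hεpos
  have hG : ∀ᵐ z ∂(Measure.addHaar : Measure X), WellPositioned (P (ε, z)) E := by
    unfold WellPositioned
    rw [ae_all_iff]; intro v
    rw [ae_all_iff]; intro w
    by_cases hvw : s(v, w) ∈ E
    · by_cases hv : v ∈ W <;> by_cases hw : w ∈ W
      · filter_upwards with z _
        rw [hPin _ v w ⟨hv, hw⟩]
        exact (hq.wellPositioned v w (hin v w hvw ⟨hv, hw⟩)).smul hεpos.ne'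
      · filter_upwards [ae_normSmooth_sub (p₀ w - p₀ h - ε • q v)] with z hz _
        simp only [P, hv, hw, if_true, if_false]
        convert hz using 1
        abel
      · filter_upwards [ae_normSmooth_sub (p₀ v - p₀ h - ε • q w)] with z hz _
        simp only [P, hv, hw, if_true, if_false]
        rw [normSmooth_sub_comm]
        convert hz using 1
        abel
      · filter_upwards with z _
        have := hp₀.wellPositioned _ _ (hout v w hvw fun h' => hv h'.1)
        rw [hπn v hv, hπn w hw] at this
        simpa only [P, hv, hw, if_false] using this
    · simp [hvw]
  obtain ⟨z, h1, h2⟩ := exists_of_eventually_of_ae hε hG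
  exact ⟨P (ε, z), h2, h1 h2⟩

end Measure

end Frameworks

section Combinatorics

variable {V : Type*} [DecidableEq V]

/-- Every nonempty vertex set `W` spans at most `2 * #W - 2` of the edges in `E`. -/
def Sparse (E : Finset (Sym2 V)) : Prop :=
  ∀ W : Finset V, W.Nonempty → (E ∩ W.sym2).card + 2 ≤ 2 * W.card

/-- The graph with vertices `U` and edges `E` is (2,2)-tight. -/
structure Tight (E : Finset (Sym2 V)) (U : Finset V) : Prop where
  subset_sym2 : E ⊆ U.sym2
  sparse : Sparse E
  card_add_two : E.card + 2 = 2 * U.card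

/-- The vertices of `W` joined to `v` by an edge in `E`. -/
def neighbors (E : Finset (Sym2 V)) (W : Finset V) (v : V) : Finset V :=
  W.filter fun w => s(v, w) ∈ E

theorem mem_neighbors {E : Finset (Sym2 V)} {W : Finset V} {v w : V} :
    w ∈ neighbors E W v ↔ w ∈ W ∧ s(v, w) ∈ E :=
  Finset.mem_filter

theorem Sparse.mono {E F : Finset (Sym2 V)} (hE : Sparse E) (hFE : F ⊆ E) : Sparse F :=
  fun W hW => le_trans (Nat.add_le_add_right
    (Finset.card_le_card (Finset.inter_subset_inter_right hFE)) 2) (hE W hW)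

theorem Sparse.diag_notMem {E : Finset (Sym2 V)} (hE : Sparse E) (v : V) : s(v, v) ∉ E := by
  intro h
  have h1 := hE {v} (Finset.singleton_nonempty v)
  have h2 : 0 < (E ∩ ({v} : Finset V).sym2).card :=
    Finset.card_pos.2 ⟨s(v, v), Finset.mem_inter.2
      ⟨h, Finset.mk_mem_sym2_iff.2 ⟨Finset.mem_singleton_self v, Finset.mem_singleton_self v⟩⟩⟩
  rw [Finset.card_singleton] at h1
  omega

theorem Tight.inter_sym2 {E : Finset (Sym2 V)} {U W : Finset V} (h : Tight E U)
    (hW : (E ∩ W.sym2).card + 2 = 2 * W.card) : Tight (E ∩ W.sym2) W :=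
  ⟨Finset.inter_subset_right, h.sparse.mono Finset.inter_subset_left, hW⟩

theorem inter_sym2_insert {E : Finset (Sym2 V)} {W : Finset V} {v : V} (hE : s(v, v) ∉ E) :
    E ∩ (insert v W).sym2 = E ∩ W.sym2 ∪ (neighbors E W v).image fun w => s(v, w) := by
  ext e
  induction e with | _ x y
  simp only [Finset.mem_inter, Finset.mk_mem_sym2_iff, Finset.mem_insert, Finset.mem_union,
    Finset.mem_image, mem_neighbors]
  constructor
  · rintro ⟨he, rfl | hx, rfl | hy⟩
    · exact absurd he hE
    · exact Or.inr ⟨y, ⟨hy, he⟩, rfl⟩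
    · exact Or.inr ⟨x, ⟨hx, Sym2.eq_swap ▸ he⟩, Sym2.eq_swap⟩
    · exact Or.inl ⟨he, hx, hy⟩
  · rintro (⟨he, hx, hy⟩ | ⟨w, ⟨hw, he⟩, hvw⟩)
    · exact ⟨he, Or.inr hx, Or.inr hy⟩
    · rw [← hvw]
      refine ⟨he, ?_⟩
      rcases Sym2.eq_iff.1 hvw with ⟨rfl, rfl⟩ | ⟨rfl, rfl⟩
      · exact ⟨Or.inl rfl, Or.inr hw⟩
      · exact ⟨Or.inr hw, Or.inl rfl⟩

theorem card_inter_sym2_insert {E : Finset (Sym2 V)} {W : Finset V} {v : V} (hE : s(v, v) ∉ E)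
    (hv : v ∉ W) :
    (E ∩ (insert v W).sym2).card = (E ∩ W.sym2).card + (neighbors E W v).card := by
  rw [inter_sym2_insert hE, Finset.card_union_of_disjoint, Finset.card_image_of_injective]
  · exact fun x y h => Sym2.congr_right.1 h
  · refine Finset.disjoint_left.2 fun e he he' => ?_
    obtain ⟨w, -, rfl⟩ := Finset.mem_image.1 he'
    exact hv (Finset.mk_mem_sym2_iff.1 (Finset.mem_inter.1 he).2).1

namespace Tight

variable {E : Finset (Sym2 V)} {U : Finset V}

theorem eq_union_neighbors (h : Tight E U) {v : V} (hv : v ∈ U) :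
    E = E ∩ (U.erase v).sym2 ∪ (neighbors E (U.erase v) v).image fun w => s(v, w) := by
  rw [← inter_sym2_insert (h.sparse.diag_notMem v), Finset.insert_erase hv,
    Finset.inter_eq_left.2 h.subset_sym2]

theorem card_eq_add_neighbors (h : Tight E U) {v : V} (hv : v ∈ U) :
    E.card = (E ∩ (U.erase v).sym2).card + (neighbors E (U.erase v) v).card := by
  rw [← card_inter_sym2_insert (h.sparse.diag_notMem v) (Finset.notMem_erase v U),
    Finset.insert_erase hv, Finset.inter_eq_left.2 h.subset_sym2]

theorem two_le_card_neighbors (h : Tight E U) (hU : 2 ≤ U.card) {v : V} (hv : v ∈ U) :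
    2 ≤ (neighbors E (U.erase v) v).card := by
  have h1 := h.card_eq_add_neighbors hv
  have h2 := h.card_add_two
  have h3 := Finset.card_erase_of_mem hv
  have h4 := h.sparse (U.erase v) (Finset.card_pos.1 (by omega))
  omega

theorem sum_card_neighbors_le (E : Finset (Sym2 V)) (U : Finset V) :
    ∑ v ∈ U, (neighbors E (U.erase v) v).card ≤ 2 * E.card := by
  calc ∑ v ∈ U, (neighbors E (U.erase v) v).card
      ≤ ∑ v ∈ U, (E.bipartiteAbove (fun v e => v ∈ e) v).card := by
        refine Finset.sum_le_sum fun v _ => ?_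
        rw [← Finset.card_image_of_injective (f := fun w => s(v, w)) _
          fun x y h => Sym2.congr_right.1 h]
        refine Finset.card_le_card fun e he => ?_
        obtain ⟨w, hw, rfl⟩ := Finset.mem_image.1 he
        exact Finset.mem_filter.2 ⟨(mem_neighbors.1 hw).2, Sym2.mem_mk_left v w⟩
    _ = ∑ e ∈ E, (U.bipartiteBelow (fun v e => v ∈ e) e).card :=
        Finset.sum_card_bipartiteAbove_eq_sum_card_bipartiteBelow _
    _ ≤ ∑ _e ∈ E, 2 := by
        refine Finset.sum_le_sum fun e _ => ?_
        induction e with | _ x y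
        refine (Finset.card_le_card (t := {x, y}) fun v hv => ?_).trans Finset.card_le_two
        simpa using (Finset.mem_filter.1 hv).2
    _ = 2 * E.card := by rw [Finset.sum_const, smul_eq_mul, mul_comm]

theorem exists_card_neighbors_le_three (h : Tight E U) :
    ∃ v ∈ U, (neighbors E (U.erase v) v).card ≤ 3 := by
  by_contra! hcon
  have h1 := Finset.card_nsmul_le_sum U _ 4 fun v hv => hcon v hv
  have h2 := sum_card_neighbors_le E U
  have h3 := h.card_add_two
  rw [smul_eq_mul] at h1
  omega

/-- Adding an edge to a graph obtained by deleting a vertex of degree three preserves tightness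
provided that no proper subgraph is tight. -/
theorem insert_edge (h : Tight E U) (hprop : ∀ W ⊆ U, 2 ≤ W.card → W.card < U.card →
      (E ∩ W.sym2).card + 2 ≠ 2 * W.card) {v a b : V} (hv : v ∈ U)
    (hdeg : (neighbors E (U.erase v) v).card = 3) (ha : a ∈ U.erase v) (hb : b ∈ U.erase v)
    (hab : a ≠ b) (habE : s(a, b) ∉ E) :
    Tight (insert s(a, b) (E ∩ (U.erase v).sym2)) (U.erase v) := by
  refine ⟨Finset.insert_subset (Finset.mk_mem_sym2_iff.2 ⟨ha, hb⟩) Finset.inter_subset_right,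
    fun W hW => ?_, ?_⟩
  · by_cases haW : s(a, b) ∈ W.sym2
    · rw [Finset.mk_mem_sym2_iff] at haW
      set W' := W ∩ U.erase v with hW'
      have hle : W'.card ≤ W.card := Finset.card_le_card Finset.inter_subset_left
      have hsub : ({a, b} : Finset V) ⊆ W' := by
        intro x hx
        simp only [Finset.mem_insert, Finset.mem_singleton] at hx
        rcases hx with rfl | rfl
        · exact Finset.mem_inter.2 ⟨haW.1, ha⟩
        · exact Finset.mem_inter.2 ⟨haW.2, hb⟩
      have h2 : 2 ≤ W'.card := Finset.card_pair hab ▸ Finset.card_le_card hsub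
      have hlt : W'.card < U.card :=
        (Finset.card_le_card Finset.inter_subset_right).trans_lt (Finset.card_erase_lt_of_mem hv)
      have h3 := hprop W' (Finset.inter_subset_right.trans (Finset.erase_subset v U)) h2 hlt
      have h4 := h.sparse W' (Finset.card_pos.1 (by omega))
      have h5 : insert s(a, b) (E ∩ (U.erase v).sym2) ∩ W.sym2 ⊆
          insert s(a, b) (E ∩ W'.sym2) := by
        intro e he
        induction e with | _ x y
        simp only [Finset.mem_inter, Finset.mem_insert, Finset.mk_mem_sym2_iff, hW'] at he ⊢
        tauto
      have h6 := (Finset.card_le_card h5).trans (Finset.card_insert_le _ _)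
      omega
    · refine le_trans (Nat.add_le_add_right (Finset.card_le_card ?_) 2) (h.sparse W hW)
      rw [Finset.insert_inter_of_notMem haW]
      exact Finset.inter_subset_inter_right Finset.inter_subset_left
  · have h1 := h.card_eq_add_neighbors hv
    have h2 := h.card_add_two
    have h3 := Finset.card_erase_of_mem hv
    rw [Finset.card_insert_of_notMem fun h' => habE (Finset.mem_inter.1 h').1]
    omega

theorem erase_of_card_neighbors_eq_two (h : Tight E U) {v : V} (hv : v ∈ U)
    (hdeg : (neighbors E (U.erase v) v).card = 2) :
    Tight (E ∩ (U.erase v).sym2) (U.erase v) := by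
  have h1 := h.card_eq_add_neighbors hv
  have h2 := h.card_add_two
  have h3 := Finset.card_erase_of_mem hv
  exact h.inter_sym2 (by omega)

/-- If no vertex outside a tight set `W` has two neighbours in `W`, then collapsing `W` to a
vertex yields a tight graph. -/
theorem image_collapse [Fintype V] (h : Tight E U) {W : Finset V} {x : V}
    (hW : Tight (E ∩ W.sym2) W) (hWU : W ⊆ U) (hx : x ∈ W)
    (hN : ∀ w ∉ W, ∀ a ∈ W, ∀ b ∈ W, s(w, a) ∈ E → s(w, b) ∈ E → a = b) :
    Tight ((E \ W.sym2).image (Sym2.map (collapse W x))) (U.image (collapse W x)) := by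
  set π := collapse W x with hπ
  have hπW : ∀ v ∈ W, π v = x := fun v hv => by simp [hπ, collapse, hv]
  have hπn : ∀ v, v ∉ W → π v = v := fun v hv => by simp [hπ, collapse, hv]
  have hπeq : ∀ v w, π v = π w → (v ∈ W ∧ w ∈ W) ∨ (v ∉ W ∧ w ∉ W ∧ v = w) := by
    intro v w hvw
    by_cases hv : v ∈ W <;> by_cases hw : w ∈ W
    · exact Or.inl ⟨hv, hw⟩
    · rw [hπW v hv, hπn w hw] at hvw
      exact absurd (hvw ▸ hx) hw
    · rw [hπn v hv, hπW w hw] at hvw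
      exact absurd (hvw ▸ hx) hv
    · rw [hπn v hv, hπn w hw] at hvw
      exact Or.inr ⟨hv, hw, hvw⟩
  have key : ∀ v w v' w', s(v, w) ∈ E → ¬ (v ∈ W ∧ w ∈ W) → s(v', w') ∈ E → π v = π v' →
      π w = π w' → s(v, w) = s(v', w') := by
    intro v w v' w' h1 h2 h3 hv hw
    rcases hπeq _ _ hv with ⟨hvW, hvW'⟩ | ⟨hvW, hvW', rfl⟩ <;>
      rcases hπeq _ _ hw with ⟨hwW, hwW'⟩ | ⟨hwW, hwW', rfl⟩
    · exact absurd ⟨hvW, hwW⟩ h2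
    · rw [hN w hwW v hvW v' hvW' (Sym2.eq_swap ▸ h1) (Sym2.eq_swap ▸ h3)]
    · rw [hN v hvW w hwW w' hwW' h1 h3]
    · rfl
  have hinj : Set.InjOn (Sym2.map π) (E \ W.sym2 : Finset (Sym2 V)) := by
    intro e he e' he' hee
    induction e with | _ v w
    induction e' with | _ v' w'
    rw [Finset.mem_coe, Finset.mem_sdiff, Finset.mk_mem_sym2_iff] at he he'
    rw [Sym2.map_mk, Sym2.map_mk] at hee
    rcases Sym2.eq_iff.1 hee with ⟨h1, h2⟩ | ⟨h1, h2⟩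
    · exact key _ _ _ _ he.1 he.2 he'.1 h1 h2
    · rw [Sym2.eq_swap (a := v')]
      exact key _ _ _ _ he.1 he.2 (Sym2.eq_swap ▸ he'.1) h1 h2
  refine ⟨fun e' he' => ?_, fun Y hY => ?_, ?_⟩
  · obtain ⟨e, he, rfl⟩ := Finset.mem_image.1 he'
    induction e with | _ v w
    have h1 := Finset.mk_mem_sym2_iff.1 (h.subset_sym2 (Finset.mem_sdiff.1 he).1)
    rw [Sym2.map_mk]
    exact Finset.mk_mem_sym2_iff.2
      ⟨Finset.mem_image_of_mem _ h1.1, Finset.mem_image_of_mem _ h1.2⟩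
  · set Z : Finset V := Finset.univ.filter fun v => π v ∈ Y with hZ
    have hle : ((E \ W.sym2).image (Sym2.map π) ∩ Y.sym2).card ≤
        ((E ∩ Z.sym2) \ W.sym2).card := by
      refine (Finset.card_le_card fun e' he' => ?_).trans
        (Finset.card_image_le (f := Sym2.map π))
      obtain ⟨h1, h2⟩ := Finset.mem_inter.1 he'
      obtain ⟨e, he, rfl⟩ := Finset.mem_image.1 h1
      refine Finset.mem_image_of_mem _ ?_
      induction e with | _ v w
      rw [Sym2.map_mk, Finset.mk_mem_sym2_iff] at h2
      simp only [Finset.mem_sdiff, Finset.mem_inter, Finset.mk_mem_sym2_iff, hZ,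
        Finset.mem_filter_univ] at he ⊢
      exact ⟨⟨he.1, h2⟩, he.2⟩
    have hYpos := hY.card_pos
    by_cases hxY : x ∈ Y
    · have hWZ : W ⊆ Z := fun v hv => by
        rw [hZ, Finset.mem_filter_univ, hπW v hv]; exact hxY
      have hZY : Z ⊆ Y.erase x ∪ W := by
        intro v hv
        rw [hZ, Finset.mem_filter_univ] at hv
        by_cases hvW : v ∈ W
        · exact Finset.mem_union_right _ hvW
        · rw [hπn v hvW] at hv
          exact Finset.mem_union_left _ (Finset.mem_erase.2 ⟨fun h' => hvW (h' ▸ hx), hv⟩)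
      have h1 := (Finset.card_le_card hZY).trans (Finset.card_union_le _ _)
      rw [Finset.card_erase_of_mem hxY] at h1
      have h2 := h.sparse Z ⟨x, hWZ hx⟩
      have h3 := hW.card_add_two
      have h4 : ((E ∩ Z.sym2) \ W.sym2).card + (E ∩ W.sym2).card = (E ∩ Z.sym2).card := by
        rw [← Finset.card_sdiff_add_card_inter (E ∩ Z.sym2) W.sym2, Finset.inter_assoc,
          Finset.inter_eq_right.2 (Finset.sym2_mono hWZ)]
      omega
    · have hZY : Z ⊆ Y := by
        intro v hv
        rw [hZ, Finset.mem_filter_univ] at hv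
        by_cases hvW : v ∈ W
        · exact absurd (hπW v hvW ▸ hv) hxY
        · rwa [hπn v hvW] at hv
      have h1 := Finset.card_le_card hZY
      have h2 := Finset.card_le_card (Finset.sdiff_subset (s := E ∩ Z.sym2) (t := W.sym2))
      rcases Z.eq_empty_or_nonempty with h3 | h3
      · have h4 : (E ∩ Z.sym2).card = 0 := by
          rw [h3, Finset.sym2_empty, Finset.inter_empty, Finset.card_empty]
        omega
      · have h4 := h.sparse Z h3
        omega
  · have h1 : U.image π = insert x (U \ W) := by
      ext v
      simp only [Finset.mem_image, Finset.mem_insert, Finset.mem_sdiff]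
      constructor
      · rintro ⟨w, hw, rfl⟩
        by_cases hwW : w ∈ W
        · exact Or.inl (hπW w hwW)
        · exact Or.inr (by rw [hπn w hwW]; exact ⟨hw, hwW⟩)
      · rintro (rfl | ⟨hv, hvW⟩)
        · exact ⟨v, hWU hx, hπW v hx⟩
        · exact ⟨v, hv, hπn v hvW⟩
    rw [Finset.card_image_of_injOn hinj, h1,
      Finset.card_insert_of_notMem fun h' => (Finset.mem_sdiff.1 h').2 hx]
    have h2 := Finset.card_sdiff_add_card_inter E W.sym2
    have h3 := hW.card_add_two
    have h4 := h.card_add_two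
    have h5 := Finset.card_sdiff_add_card_eq_card hWU
    omega

end Tight

end Combinatorics

section Realization

variable {X : Type*} [NormedAddCommGroup X] [NormedSpace ℝ X] [FiniteDimensional ℝ X]
  [MeasurableSpace X] [BorelSpace X] {V : Type*} [Fintype V] [DecidableEq V]
  {E : Finset (Sym2 V)} {U : Finset V}

omit [FiniteDimensional ℝ X] [MeasurableSpace X] [BorelSpace X] [Fintype V] [DecidableEq V] in
theorem exists_realizes_empty (v : V) : ∃ p : V → X, Realizes p ∅ {v} := by
  refine ⟨0, fun _ _ h => absurd h (Finset.notMem_empty _), fun u _ a ha b hb => ?_⟩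
  rw [Finset.mem_singleton.1 ha, Finset.mem_singleton.1 hb]

namespace Tight

theorem exists_realizes_of_card_neighbors_eq_two (hdim : Module.finrank ℝ X = 2)
    (h : Tight E U) {v : V} (hv : v ∈ U) (hdeg : (neighbors E (U.erase v) v).card = 2)
    {p : V → X} (hp : Realizes p (E ∩ (U.erase v).sym2) (U.erase v)) :
    ∃ q : V → X, Realizes q E U := by
  obtain ⟨a, b, hab, hN⟩ := Finset.card_eq_two.1 hdeg
  have ha : a ∈ neighbors E (U.erase v) v := by simp [hN]
  have hb : b ∈ neighbors E (U.erase v) v := by simp [hN]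
  have hE := h.eq_union_neighbors hv
  rw [hN, Finset.image_insert, Finset.image_singleton] at hE
  obtain ⟨q, hq⟩ := hp.zero_extension hdim Finset.inter_subset_right (Finset.notMem_erase v U)
    (mem_neighbors.1 ha).1 (mem_neighbors.1 hb).1 hab
  refine ⟨q, ?_⟩
  rw [Finset.insert_erase hv] at hq
  convert hq using 1
  rw [hE]
  ext e
  simp only [Finset.mem_union, Finset.mem_insert, Finset.mem_singleton, Finset.mem_inter]
  tauto

theorem exists_realizes_of_insert_edge (hdim : Module.finrank ℝ X = 2)
    (h : Tight E U) {v a b c : V} (hv : v ∈ U) (hN : neighbors E (U.erase v) v = {a, b, c})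
    (hca : c ≠ a) (hcb : c ≠ b) {p : V → X}
    (hp : Realizes p (insert s(a, b) (E ∩ (U.erase v).sym2)) (U.erase v)) :
    ∃ q : V → X, Realizes q E U := by
  have ha : a ∈ neighbors E (U.erase v) v := by simp [hN]
  have hb : b ∈ neighbors E (U.erase v) v := by simp [hN]
  have hc : c ∈ neighbors E (U.erase v) v := by simp [hN]
  have hE := h.eq_union_neighbors hv
  rw [hN, Finset.image_insert, Finset.image_insert, Finset.image_singleton] at hE
  obtain ⟨q, hq⟩ := hp.one_extension hdim
    (Finset.insert_subset
      (Finset.mk_mem_sym2_iff.2 ⟨(mem_neighbors.1 ha).1, (mem_neighbors.1 hb).1⟩)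
      Finset.inter_subset_right) (Finset.notMem_erase v U) (mem_neighbors.1 hc).1 hca hcb
  refine ⟨q, ?_⟩
  rw [Finset.insert_erase hv] at hq
  convert hq using 1
  rw [hE]
  ext e
  simp only [Finset.mem_union, Finset.mem_insert, Finset.mem_singleton, Finset.mem_inter]
  tauto

omit [Fintype V] in
/-- A tight graph containing a complete graph on four vertices and no proper tight subgraph is
that complete graph. -/
theorem eq_of_complete (h : Tight E U) (hprop : ∀ W ⊆ U, 2 ≤ W.card → W.card < U.card →
      (E ∩ W.sym2).card + 2 ≠ 2 * W.card) {v a b c : V} (hU : ({v, a, b, c} : Finset V) ⊆ U)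
    (hva : v ≠ a) (hvb : v ≠ b) (hvc : v ≠ c) (hab : a ≠ b) (hac : a ≠ c) (hbc : b ≠ c)
    (hE : ({s(v, a), s(v, b), s(v, c), s(a, b), s(a, c), s(b, c)} : Finset (Sym2 V)) ⊆ E) :
    {v, a, b, c} = U ∧
      ({s(v, a), s(v, b), s(v, c), s(a, b), s(a, c), s(b, c)} : Finset (Sym2 V)) = E := by
  set K : Finset (Sym2 V) := {s(v, a), s(v, b), s(v, c), s(a, b), s(a, c), s(b, c)} with hK
  set W : Finset V := {v, a, b, c} with hW
  have hWc : W.card = 4 := by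
    rw [hW, Finset.card_eq_succ]
    exact ⟨v, {a, b, c}, by simp [*], rfl, Finset.card_eq_three.2 ⟨a, b, c, hab, hac, hbc, rfl⟩⟩
  have hKc : K.card = 6 := by
    rw [hK]
    repeat rw [Finset.card_insert_of_notMem (by
      simp [hva, hvb, hvc, hab, hac, hbc, hva.symm, hvb.symm, hab.symm, hac.symm, hbc.symm])]
    rw [Finset.card_singleton]
  have hKW : K ⊆ W.sym2 := by
    intro e he
    simp only [hK, Finset.mem_insert, Finset.mem_singleton] at he
    rcases he with rfl | rfl | rfl | rfl | rfl | rfl <;> simp [hW]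
  have h1 := Finset.card_le_card (Finset.subset_inter hE hKW)
  have h2 := h.sparse W (Finset.card_pos.1 (by omega))
  have h3 := hprop W hU (by omega)
  have h4 := Finset.card_le_card hU
  have h5 : W = U := Finset.eq_of_subset_of_card_le hU (by omega)
  refine ⟨h5, Finset.eq_of_subset_of_card_le hE ?_⟩
  have h6 := h.card_add_two
  rw [← h5] at h6
  omega

theorem exists_realizes (hdim : Module.finrank ℝ X = 2) {x y : X} (hxy : RigidParallelogram x y)
    (h : Tight E U) : ∃ p : V → X, Realizes p E U := by
  induction hn : U.card using Nat.strong_induction_on generalizing E U with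
  | _ n ih =>
  replace ih : ∀ (F : Finset (Sym2 V)) (W : Finset V), Tight F W → W.card < U.card →
      ∃ p : V → X, Realizes p F W := fun F W hF hW => ih W.card (hn ▸ hW) hF rfl
  have hcard := h.card_add_two
  rcases Nat.lt_or_ge U.card 2 with hU | hU
  · obtain ⟨v, rfl⟩ := Finset.card_eq_one.1 (show U.card = 1 by omega)
    rw [Finset.card_singleton] at hcard
    rw [Finset.card_eq_zero.1 (show E.card = 0 by omega)]
    exact exists_realizes_empty v
  by_cases h2 : ∃ v ∈ U, (neighbors E (U.erase v) v).card = 2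
  · obtain ⟨v, hv, hdeg⟩ := h2
    obtain ⟨p, hp⟩ := ih _ _ (h.erase_of_card_neighbors_eq_two hv hdeg)
      (Finset.card_erase_lt_of_mem hv)
    exact h.exists_realizes_of_card_neighbors_eq_two hdim hv hdeg hp
  push Not at h2
  by_cases hprop : ∀ W ⊆ U, 2 ≤ W.card → W.card < U.card → (E ∩ W.sym2).card + 2 ≠ 2 * W.card
  · obtain ⟨v, hv, hdeg⟩ := h.exists_card_neighbors_le_three
    replace hdeg : (neighbors E (U.erase v) v).card = 3 := by
      have := h.two_le_card_neighbors hU hv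
      have := h2 v hv
      omega
    obtain ⟨a, b, c, hab, hac, hbc, hN⟩ := Finset.card_eq_three.1 hdeg
    have hmem : ∀ w ∈ ({a, b, c} : Finset V), w ∈ U.erase v ∧ s(v, w) ∈ E := fun w hw =>
      mem_neighbors.1 (hN ▸ hw)
    obtain ⟨ha, hva⟩ := hmem a (by simp)
    obtain ⟨hb, hvb⟩ := hmem b (by simp)
    obtain ⟨hc, hvc⟩ := hmem c (by simp)
    have hlt := Finset.card_erase_lt_of_mem hv
    by_cases habE : s(a, b) ∈ E
    swap
    · obtain ⟨p, hp⟩ := ih _ _ (h.insert_edge hprop hv hdeg ha hb hab habE) hlt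
      exact h.exists_realizes_of_insert_edge hdim hv hN hac.symm hbc.symm hp
    by_cases hacE : s(a, c) ∈ E
    swap
    · obtain ⟨p, hp⟩ := ih _ _ (h.insert_edge hprop hv hdeg ha hc hac hacE) hlt
      exact h.exists_realizes_of_insert_edge hdim hv
        (by rw [hN, Finset.pair_comm b c]) hab.symm hbc hp
    by_cases hbcE : s(b, c) ∈ E
    swap
    · obtain ⟨p, hp⟩ := ih _ _ (h.insert_edge hprop hv hdeg hb hc hbc hbcE) hlt
      exact h.exists_realizes_of_insert_edge hdim hv
        (by rw [hN, Finset.insert_comm, Finset.pair_comm a c]) hab hac hp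
    have hva' := (Finset.ne_of_mem_erase ha).symm
    have hvb' := (Finset.ne_of_mem_erase hb).symm
    have hvc' := (Finset.ne_of_mem_erase hc).symm
    obtain ⟨rfl, rfl⟩ := h.eq_of_complete hprop (v := v) (a := a) (b := b) (c := c)
      (by simp [Finset.insert_subset_iff, hv, Finset.mem_of_mem_erase ha,
        Finset.mem_of_mem_erase hb, Finset.mem_of_mem_erase hc]) hva' hvb' hvc' hab hac hbc
      (by simp only [Finset.insert_subset_iff, Finset.singleton_subset_iff]
          exact ⟨hva, hvb, hvc, habE, hacE, hbcE⟩)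
    exact hxy.exists_realizes hva' hvb' hvc' hab hac hbc
  · push Not at hprop
    obtain ⟨W₀, hW₀U, hW₀⟩ := hprop
    obtain ⟨W, hW, hmax⟩ := Finset.exists_max_image
      (U.powerset.filter fun W => 2 ≤ W.card ∧ W.card < U.card ∧
        (E ∩ W.sym2).card + 2 = 2 * W.card) Finset.card
      ⟨W₀, Finset.mem_filter.2 ⟨Finset.mem_powerset.2 hW₀U, hW₀⟩⟩
    obtain ⟨hWU, hW2, hWlt, hWt⟩ := Finset.mem_filter.1 hW
    rw [Finset.mem_powerset] at hWU
    have hWtight := h.inter_sym2 hWt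
    obtain ⟨x, hx⟩ := Finset.card_pos.1 (show 0 < W.card by omega)
    have hN : ∀ w ∉ W, ∀ a ∈ W, ∀ b ∈ W, s(w, a) ∈ E → s(w, b) ∈ E → a = b := by
      intro w hw a ha b hb hwa hwb
      by_contra hab
      have hwU : w ∈ U := (Finset.mk_mem_sym2_iff.1 (h.subset_sym2 hwa)).1
      have hsub : ({a, b} : Finset V) ⊆ neighbors E W w := by
        simp only [Finset.insert_subset_iff, Finset.singleton_subset_iff, mem_neighbors]
        exact ⟨⟨ha, hwa⟩, hb, hwb⟩
      have h3 := Finset.card_le_card hsub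
      rw [Finset.card_pair hab] at h3
      have h4 := card_inter_sym2_insert (h.sparse.diag_notMem w) hw
      have h5 := h.sparse _ (Finset.insert_nonempty w W)
      have h6 := Finset.card_insert_of_notMem hw
      have h7 : insert w W ⊆ U := Finset.insert_subset hwU hWU
      by_cases h8 : (insert w W).card < U.card
      · have := hmax (insert w W)
          (Finset.mem_filter.2 ⟨Finset.mem_powerset.2 h7, by omega, h8, by omega⟩)
        omega
      · have h9 := Finset.eq_of_subset_of_card_le h7 (by omega)
        have h10 : U.erase w = W := by rw [← h9, Finset.erase_insert hw]
        have h11 := h2 w hwU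
        rw [h10] at h11
        omega
    have himg := h.image_collapse hWtight hWU hx hN
    have hlt : (U.image (collapse W x)).card < U.card := by
      have h3 : U.image (collapse W x) ⊆ insert x (U \ W) := by
        intro v hv
        obtain ⟨w, hw, rfl⟩ := Finset.mem_image.1 hv
        by_cases hwW : w ∈ W <;> simp [collapse, hwW, hw]
      have h4 := (Finset.card_le_card h3).trans (Finset.card_insert_le _ _)
      have h5 := Finset.card_sdiff_add_card_eq_card hWU
      omega
    obtain ⟨q, hq⟩ := ih _ _ hWtight hWlt
    obtain ⟨p₀, hp₀⟩ := ih _ _ himg hlt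
    exact Realizes.exists_of_collapse hdim h.subset_sym2 hx hq hp₀

end Tight

end Realization

section RigidityOperator

variable {X : Type*} [NormedAddCommGroup X] [NormedSpace ℝ X] {V : Type*}

/-- The rigidity operator of the placement `p` on the edge set `F`, each edge being oriented by
its chosen representative. -/
noncomputable def rigidityOperator (p : V → X) (F : Set (Sym2 V)) : (V → X) →ₗ[ℝ] (F → ℝ) :=
  LinearMap.pi fun e => (normDeriv (p e.1.out.1 - p e.1.out.2)).toLinearMap ∘ₗ
    (LinearMap.proj (R := ℝ) (φ := fun _ : V => X) e.1.out.1 - LinearMap.proj e.1.out.2)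

theorem rigidityOperator_apply (p u : V → X) {F : Set (Sym2 V)} {v w : V} (h : s(v, w) ∈ F) :
    rigidityOperator p F u ⟨s(v, w), h⟩ = normDeriv (p v - p w) (u v - u w) := by
  have h1 : s((s(v, w) : Sym2 V).out.1, (s(v, w) : Sym2 V).out.2) = s(v, w) :=
    Quot.out_eq (s(v, w) : Sym2 V)
  change normDeriv (p (s(v, w) : Sym2 V).out.1 - p (s(v, w) : Sym2 V).out.2)
    (u (s(v, w) : Sym2 V).out.1 - u (s(v, w) : Sym2 V).out.2) = _
  rcases Sym2.eq_iff.1 h1 with ⟨h2, h3⟩ | ⟨h2, h3⟩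
  · rw [h2, h3]
  · rw [h2, h3, normDeriv_sub_comm_apply]

theorem rigidityOperator_eq_iff (p u : V → X) {F : Set (Sym2 V)} {m : F → ℝ} :
    rigidityOperator p F u = m ↔
      ∀ (v w : V) (h : s(v, w) ∈ F), normDeriv (p v - p w) (u v - u w) = m ⟨s(v, w), h⟩ := by
  constructor
  · rintro rfl v w h
    exact (rigidityOperator_apply p u h).symm
  · intro h
    funext ⟨e, he⟩
    induction e with | _ v w
    rw [rigidityOperator_apply, h v w he]

theorem rigidityOperator_eq_zero_iff (p u : V → X) {F : Set (Sym2 V)} :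
    rigidityOperator p F u = 0 ↔
      ∀ v w : V, s(v, w) ∈ F → normDeriv (p v - p w) (u v - u w) = 0 :=
  rigidityOperator_eq_iff p u

theorem rigidityOperator_surjective_iff (p : V → X) {F : Set (Sym2 V)} :
    Function.Surjective (rigidityOperator p F) ↔ ∀ m : F → ℝ, ∃ u : V → X,
      ∀ (v w : V) (h : s(v, w) ∈ F), normDeriv (p v - p w) (u v - u w) = m ⟨s(v, w), h⟩ :=
  forall_congr' fun _ => exists_congr fun u => rigidityOperator_eq_iff p u

theorem rigidityOperator_surjective_mono {p : V → X} {F F' : Set (Sym2 V)} (h : F' ⊆ F)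
    (hF : Function.Surjective (rigidityOperator p F)) :
    Function.Surjective (rigidityOperator p F') := by
  classical
  rw [rigidityOperator_surjective_iff] at hF ⊢
  intro m
  obtain ⟨u, hu⟩ := hF fun e => if he : e.1 ∈ F' then m ⟨e.1, he⟩ else 0
  refine ⟨u, fun v w hvw => ?_⟩
  rw [hu v w (h hvw), dif_pos hvw]

variable [Fintype V]

theorem finrank_pi_plane (hdim : Module.finrank ℝ X = 2) {ι : Type*} [Fintype ι] :
    Module.finrank ℝ (ι → X) = 2 * Fintype.card ι := by
  have : FiniteDimensional ℝ X := FiniteDimensional.of_finrank_pos (by omega)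
  rw [Module.finrank_pi_fintype, Finset.sum_const, hdim, smul_eq_mul, mul_comm, Finset.card_univ]

theorem finrank_range_add_finrank_ker_rigidityOperator (hdim : Module.finrank ℝ X = 2)
    (p : V → X) (F : Set (Sym2 V)) :
    Module.finrank ℝ (LinearMap.range (rigidityOperator p F)) +
      Module.finrank ℝ (LinearMap.ker (rigidityOperator p F)) = 2 * Fintype.card V := by
  have : FiniteDimensional ℝ X := FiniteDimensional.of_finrank_pos (by omega)
  rw [LinearMap.finrank_range_add_finrank_ker, finrank_pi_plane hdim]

theorem finrank_range_of_surjective {p : V → X} {F : Set (Sym2 V)}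
    (h : Function.Surjective (rigidityOperator p F)) :
    Module.finrank ℝ (LinearMap.range (rigidityOperator p F)) = F.ncard := by
  classical
  have := Fintype.ofFinite F
  rw [LinearMap.range_eq_top.2 h, finrank_top, Module.finrank_fintype_fun_eq_card,
    ← Nat.card_eq_fintype_card, Nat.card_coe_set_eq]

omit [Fintype V] in
theorem finrank_ker_of_rigid (hdim : Module.finrank ℝ X = 2) [Nonempty V] {p : V → X}
    {F : Set (Sym2 V)} (h : ∀ u : V → X, rigidityOperator p F u = 0 ↔ ∃ c, ∀ v, u v = c) :
    Module.finrank ℝ (LinearMap.ker (rigidityOperator p F)) = 2 := by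
  let T : X →ₗ[ℝ] (V → X) := LinearMap.pi fun _ => LinearMap.id
  have hT : LinearMap.ker (rigidityOperator p F) = LinearMap.range T := by
    ext u
    rw [LinearMap.mem_ker, h, LinearMap.mem_range]
    exact exists_congr fun c => ⟨fun hu => funext fun v => (hu v).symm,
      fun hu v => (congrFun hu v).symm⟩
  rw [hT, LinearMap.finrank_range_of_inj, hdim]
  exact fun x y hxy => congrFun hxy (Classical.arbitrary V)

/-- The motions which are constant on `W` lie in the kernel of the rigidity operator of a graph
with vertices in `W`. -/
theorem le_finrank_ker_rigidityOperator (hdim : Module.finrank ℝ X = 2) (p : V → X)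
    {F : Set (Sym2 V)} {W : Finset V} (hW : W.Nonempty)
    (hF : ∀ v w, s(v, w) ∈ F → v ∈ W ∧ w ∈ W) :
    2 + 2 * Fintype.card V ≤
      Module.finrank ℝ (LinearMap.ker (rigidityOperator p F)) + 2 * W.card := by
  classical
  have : FiniteDimensional ℝ X := FiniteDimensional.of_finrank_pos (by omega)
  obtain ⟨v₀, hv₀⟩ := hW
  let T : (X × ({v // v ∉ W} → X)) →ₗ[ℝ] (V → X) :=
    LinearMap.pi fun v => if hv : v ∈ W then LinearMap.fst ℝ _ _
      else LinearMap.proj (⟨v, hv⟩ : {v // v ∉ W}) ∘ₗ LinearMap.snd ℝ _ _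
  have hTin : ∀ z, ∀ v ∈ W, T z v = z.1 := fun z v hv => by simp [T, hv]
  have hTout : ∀ z, ∀ v (hv : v ∉ W), T z v = z.2 ⟨v, hv⟩ := fun z v hv => by simp [T, hv]
  have hinj : Function.Injective T := by
    intro z z' hz
    refine Prod.ext ?_ (funext fun ⟨v, hv⟩ => ?_)
    · rw [← hTin z v₀ hv₀, hz, hTin z' v₀ hv₀]
    · rw [← hTout z v hv, hz, hTout z' v hv]
  have hker : LinearMap.range T ≤ LinearMap.ker (rigidityOperator p F) := by
    rintro _ ⟨z, rfl⟩
    rw [LinearMap.mem_ker, rigidityOperator_eq_zero_iff]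
    intro v w hvw
    rw [hTin z v (hF v w hvw).1, hTin z w (hF v w hvw).2, sub_self, map_zero]
  have h1 := Submodule.finrank_mono hker
  rw [LinearMap.finrank_range_of_inj hinj, Module.finrank_prod, finrank_pi_plane hdim, hdim,
    Fintype.card_subtype_compl, Fintype.card_coe] at h1
  have h2 := Finset.card_le_univ W
  omega

end RigidityOperator

section Graphs

variable {X : Type*} [NormedAddCommGroup X] [NormedSpace ℝ X] {V : Type*} [Fintype V]

theorem ncard_edgeSet_le_of_surjective (hdim : Module.finrank ℝ X = 2) {G : SimpleGraph V}
    {p : V → X} (hp : Function.Surjective (rigidityOperator p G.edgeSet)) (H : G.Subgraph)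
    (hH : H.verts.Nonempty) : H.edgeSet.ncard ≤ 2 * H.verts.ncard - 2 := by
  classical
  have h1 := rigidityOperator_surjective_mono H.edgeSet_subset hp
  have h2 := finrank_range_add_finrank_ker_rigidityOperator hdim p H.edgeSet
  have h3 := le_finrank_ker_rigidityOperator hdim p (F := H.edgeSet) (W := H.verts.toFinset)
    (Set.toFinset_nonempty.2 hH) fun v w hvw => by
      rw [SimpleGraph.Subgraph.mem_edgeSet] at hvw
      exact ⟨Set.mem_toFinset.2 hvw.fst_mem, Set.mem_toFinset.2 hvw.snd_mem⟩
  rw [finrank_range_of_surjective h1] at h2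
  rw [← Set.ncard_eq_toFinset_card'] at h3
  omega

theorem tight_edgeFinset [DecidableEq V] [Nonempty V] {G : SimpleGraph V} [DecidableRel G.Adj]
    (hG : ∀ H : G.Subgraph, H.verts.Nonempty → H.edgeSet.ncard ≤ 2 * H.verts.ncard - 2)
    (hcard : G.edgeSet.ncard = 2 * Fintype.card V - 2) :
    Tight G.edgeFinset Finset.univ := by
  refine ⟨by simp, fun W hW => ?_, ?_⟩
  · have h1 := hG ((⊤ : G.Subgraph).induce W) hW
    have h2 : ((⊤ : G.Subgraph).induce W).edgeSet = (G.edgeFinset ∩ W.sym2 : Finset (Sym2 V)) := by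
      ext e
      induction e with | _ v w
      simp
      tauto
    rw [h2, Set.ncard_coe_finset, SimpleGraph.Subgraph.induce_verts, Set.ncard_coe_finset] at h1
    have h3 := hW.card_pos
    omega
  · rw [← Set.ncard_coe_finset, SimpleGraph.coe_edgeFinset, hcard, Finset.card_univ]
    have := Fintype.card_pos (α := V)
    omega

end Graphs

end NormedPlane

open NormedPlane

/-- In a non-Euclidean normed plane `X`, a finite simple graph `G`
with at least one vertex is isostatic (admits a well-positioned placement whose
rigidity operator is surjective with kernel exactly the constant maps) if and only
if `G` is (2,2)-tight. -/
theorem isostatic_iff_two_two_tight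
    (X : Type*) [NormedAddCommGroup X] [NormedSpace ℝ X]
    (hdim : Module.finrank ℝ X = 2)
    (hnE : ∃ x y : X, ‖x + y‖ ^ 2 + ‖x - y‖ ^ 2 ≠ 2 * ‖x‖ ^ 2 + 2 * ‖y‖ ^ 2)
    (V : Type*) [Fintype V] [Nonempty V] (G : SimpleGraph V) :
    (∃ p : V → X,
      (∀ v w : V, G.Adj v w → DifferentiableAt ℝ (fun x : X => ‖x‖) (p v - p w)) ∧
      (∀ m : G.edgeSet → ℝ, ∃ u : V → X, ∀ (v w : V) (h : G.Adj v w),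
        fderiv ℝ (fun x : X => ‖x‖) (p v - p w) (u v - u w)
          = m ⟨s(v, w), (G.mem_edgeSet).mpr h⟩) ∧
      (∀ u : V → X,
        (∀ v w : V, G.Adj v w →
            fderiv ℝ (fun x : X => ‖x‖) (p v - p w) (u v - u w) = 0)
          ↔ ∃ c : X, ∀ v, u v = c))
    ↔ ((∀ H : G.Subgraph, H.verts.Nonempty →
          H.edgeSet.ncard ≤ 2 * H.verts.ncard - 2) ∧
        G.edgeSet.ncard = 2 * Fintype.card V - 2) := by
  classical
  have hfin : FiniteDimensional ℝ X := FiniteDimensional.of_finrank_pos (by omega)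
  constructor
  · rintro ⟨p, -, hsurj, hker⟩
    have hs : Function.Surjective (rigidityOperator p G.edgeSet) :=
      (rigidityOperator_surjective_iff p).2 hsurj
    refine ⟨ncard_edgeSet_le_of_surjective hdim hs, ?_⟩
    have h1 := finrank_range_add_finrank_ker_rigidityOperator hdim p G.edgeSet
    rw [finrank_range_of_surjective hs, finrank_ker_of_rigid hdim fun u =>
      (rigidityOperator_eq_zero_iff p u).trans (hker u)] at h1
    omega
  · rintro ⟨hsub, hcard⟩
    let : MeasurableSpace X := borel X
    have : BorelSpace X := ⟨rfl⟩
    obtain ⟨x, y, hxy⟩ := exists_rigidParallelogram hdim hnE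
    obtain ⟨p, hp⟩ := (tight_edgeFinset hsub hcard).exists_realizes hdim hxy
    have hker : ∀ u : V → X, (∀ v w : V, G.Adj v w → normDeriv (p v - p w) (u v - u w) = 0) ↔
        ∃ c : X, ∀ v, u v = c := by
      refine fun u => ⟨fun hu => ?_, ?_⟩
      · obtain ⟨v₀⟩ := ‹Nonempty V›
        exact ⟨u v₀, fun v => hp.rigid u (fun v w hvw => hu v w (by simpa using hvw)) v
          (Finset.mem_univ v) v₀ (Finset.mem_univ v₀)⟩
      · rintro ⟨c, hc⟩ v w -
        rw [hc v, hc w, sub_self, map_zero]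
    refine ⟨p, fun v w hvw => hp.wellPositioned v w (by simpa using hvw),
      (rigidityOperator_surjective_iff p).1 ?_, hker⟩
    have h1 := finrank_range_add_finrank_ker_rigidityOperator hdim p G.edgeSet
    rw [finrank_ker_of_rigid hdim fun u => (rigidityOperator_eq_zero_iff p u).trans (hker u)] at h1
    rw [← LinearMap.range_eq_top]
    refine Submodule.eq_top_of_finrank_eq ?_
    rw [Module.finrank_fintype_fun_eq_card, ← Nat.card_eq_fintype_card, Nat.card_coe_set_eq, hcard]
    omega
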